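/- arXiv:1401.7263 — 4 statements merged into one kernel-verified Lean document; each statement's English description precedes it below -/
import Mathlib

section
/- Let G be a pair of d-dimensional butterflies and let m ≤ d. For every set A of input nodes and every set B of output nodes with |A| = |B| = 2^d − 2^m, there exist |A| node-disjoint directed paths from A to B. -/
/-- A binary string of length `d`. -/
abbrev BStr (d : ℕ) := Fin d → Bool

/-- Adjacency relation of a pair of `d`-dimensional butterflies: two standard
`d`-dimensional butterflies concatenated by identifying output node `b` of the
left butterfly with input node `τ b` of the right butterfly (every graph
obtained by concatenating two graphs isomorphic to the standard butterfly is of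
this form, up to isomorphism).  A node is a pair (layer, string) with layers
`0,…,2d`; nodes on layers `0,…,d-1` carry left-butterfly labels, and nodes on
layers `d,…,2d` carry right-butterfly labels. -/
def pairAdj (d : ℕ) (τ : BStr d ≃ BStr d)
    (u v : Fin (2*d+1) × BStr d) : Prop :=
  (u.1 : ℕ) + 1 = (v.1 : ℕ) ∧
  (((v.1 : ℕ) < d ∧ ∀ j : Fin d, (j : ℕ) ≠ (u.1 : ℕ) → u.2 j = v.2 j) ∨
   ((v.1 : ℕ) = d ∧ ∀ j : Fin d, (j : ℕ) ≠ (u.1 : ℕ) → u.2 j = τ.symm v.2 j) ∨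
   (d ≤ (u.1 : ℕ) ∧ ∀ j : Fin d, (j : ℕ) ≠ (u.1 : ℕ) - d → u.2 j = v.2 j))

/-- `P` is a system of node-disjoint directed paths of the layered graph with
adjacency `Adj`, one path starting at each input node (layer `0`) in `A`, such
that the endpoints (on layer `2d`) are exactly the members of `B`.  (Any
directed path from layer `0` to layer `2d` passes through each layer exactly
once, so it is faithfully recorded by the string it visits on each layer.) -/
def IsPathSystemOn (d : ℕ)
    (Adj : Fin (2*d+1) × BStr d → Fin (2*d+1) × BStr d → Prop)
    (A B : Finset (BStr d)) (P : BStr d → Fin (2*d+1) → BStr d) : Prop :=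
  (∀ a ∈ A, P a 0 = a) ∧
  (∀ a ∈ A, ∀ i : Fin (2*d), Adj (i.castSucc, P a i.castSucc) (i.succ, P a i.succ)) ∧
  (∀ a ∈ A, P a (Fin.last (2*d)) ∈ B) ∧
  (∀ b ∈ B, ∃ a ∈ A, P a (Fin.last (2*d)) = b) ∧
  (∀ a ∈ A, ∀ a' ∈ A, a ≠ a' → ∀ i, P a i ≠ P a' i)

open Finset in
/-- Integrality of unit-capacity circulations: a finite circulation with vertex loads at most `1`
contains a permutation each of whose points either moves along the support of the flow, or is fixed
and not saturated. -/
theorem exists_perm_of_circulation {V : Type*} [Fintype V] [DecidableEq V]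
    (f : V → V → ℝ) (load : V → ℝ) (hf : ∀ u v, 0 ≤ f u v)
    (hrow : ∀ u, ∑ v, f u v = load u) (hcol : ∀ v, ∑ u, f u v = load v)
    (hload : ∀ u, load u ≤ 1) :
    ∃ σ : Equiv.Perm V, ∀ u, 0 < f u (σ u) ∨ (σ u = u ∧ load u < 1) := by
  let M : Matrix V V ℝ := fun u v => f u v + if u = v then 1 - load u else 0
  have hM : M ∈ doublyStochastic ℝ V := by
    rw [mem_doublyStochastic_iff_sum]
    refine ⟨fun u v => ?_, fun u => ?_, fun v => ?_⟩
    · have := hload u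
      have := hf u v
      simp only [M]
      split_ifs <;> linarith
    · simp [M, sum_add_distrib, hrow]
    · simp [M, sum_add_distrib, hcol]
  obtain ⟨w, hw, hw1, hwM⟩ := exists_eq_sum_perm_of_mem_doublyStochastic hM
  obtain ⟨σ, -, hσ⟩ : ∃ σ ∈ univ, 0 < w σ :=
    exists_lt_of_sum_lt (s := univ) (f := fun _ => (0 : ℝ)) (g := w) (by simp [hw1])
  refine ⟨σ, fun u => ?_⟩
  have hpos : 0 < M u (σ u) := by
    rw [← hwM, Matrix.sum_apply]
    refine sum_pos' (fun π _ => ?_) ⟨σ, mem_univ _, ?_⟩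
    · simp only [Matrix.smul_apply, smul_eq_mul]
      refine mul_nonneg (hw π) ?_
      rw [Equiv.Perm.permMatrix, PEquiv.toMatrix_apply]
      split_ifs <;> simp
    · simpa [Equiv.Perm.permMatrix, PEquiv.toMatrix_apply] using hσ
  rcases (hf u (σ u)).lt_or_eq with h | h
  · exact Or.inl h
  · right
    simp only [M, ← h, zero_add] at hpos
    split_ifs at hpos with h'
    · exact ⟨h'.symm, by linarith⟩
    · exact absurd hpos (lt_irrefl _)

open Finset in
/-- Integrality of layered unit-capacity flows: a flow through layers `0, …, n` from `A` to `B`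
contains `|A|` node-disjoint paths. -/
theorem exists_disjoint_paths_of_layered_flow {W : Type*} [Fintype W] [DecidableEq W]
    (n : ℕ) (A B : Finset W) (hAB : #A = #B) (f : ℕ → W → W → ℝ) (load : ℕ → W → ℝ)
    (hf : ∀ i u v, 0 ≤ f i u v)
    (hrow : ∀ i < n, ∀ u, ∑ v, f i u v = load i u)
    (hcol : ∀ i < n, ∀ v, ∑ u, f i u v = load (i + 1) v)
    (hload : ∀ i u, load i u ≤ 1)
    (hA : ∀ u, load 0 u = if u ∈ A then 1 else 0)
    (hB : ∀ u, load n u = if u ∈ B then 1 else 0) :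
    ∃ P : W → ℕ → W, (∀ a ∈ A, P a 0 = a) ∧
      (∀ a ∈ A, ∀ i < n, 0 < f i (P a i) (P a (i + 1))) ∧
      (∀ a ∈ A, P a n ∈ B) ∧
      (∀ a ∈ A, ∀ a' ∈ A, a ≠ a' → ∀ i ≤ n, P a i ≠ P a' i) := by
  rcases A.eq_empty_or_nonempty with rfl | hne
  · exact ⟨fun a _ => a, by simp⟩
  rcases n.eq_zero_or_pos with rfl | hn
  · refine ⟨fun a _ => a, by simp, by simp, fun a ha => ?_, by simp⟩
    have h := hB a
    rw [hA, if_pos ha] at h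
    by_contra hb
    simp [hb] at h
  have hcard : (#A : ℝ) ≠ 0 := by exact_mod_cast hne.card_ne_zero
  have hcardB : (#B : ℝ) ≠ 0 := by rwa [← hAB]
  -- close the flow up to a circulation by returning uniformly from `B` to `A`
  let g : Fin (n + 1) → W → W → ℝ := fun i u v =>
    if (i : ℕ) = n then if u ∈ B ∧ v ∈ A then (#A : ℝ)⁻¹ else 0 else f i u v
  have hg : ∀ i u v, 0 ≤ g i u v := by
    intro i u v
    simp only [g]
    split_ifs
    · positivity
    · exact le_rfl
    · exact hf _ _ _
  have hsucc : ∀ i : Fin (n + 1), (i : ℕ) ≠ n → ((i + 1 : Fin (n + 1)) : ℕ) = i + 1 := by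
    intro i hi
    rw [Fin.val_add_one, if_neg]
    exact fun h => hi (by rw [h]; rfl)
  have hgrow : ∀ i u, ∑ v, g i u v = load i u := by
    intro i u
    by_cases hi : (i : ℕ) = n
    · rw [hi, hB]
      by_cases hu : u ∈ B <;> simp [g, hi, hu, hcard]
    · simp only [g, hi, if_false]
      exact hrow _ (by omega) u
  have hgcol : ∀ i v, ∑ u, g i u v = load (i + 1 : Fin (n + 1)) v := by
    intro i v
    by_cases hi : (i : ℕ) = n
    · have h0 : ((i + 1 : Fin (n + 1)) : ℕ) = 0 := by
        rw [Fin.val_add_one, if_pos (Fin.ext hi)]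
      rw [h0, hA]
      by_cases hv : v ∈ A <;> simp [g, hi, hv, hAB, hcardB]
    · simp only [g, hi, if_false, hsucc i hi]
      exact hcol _ (by omega) v
  let F : Fin (n + 1) × W → Fin (n + 1) × W → ℝ := fun u v =>
    if v.1 = u.1 + 1 then g u.1 u.2 v.2 else 0
  obtain ⟨σ, hσ⟩ := exists_perm_of_circulation F (fun u => load u.1 u.2)
    (fun u v => by simp only [F]; split_ifs <;> simp [hg])
    (fun u => by
      rw [Fintype.sum_prod_type, sum_comm, ← hgrow]
      simp [F])
    (fun v => by
      have h : ∀ i : Fin (n + 1), v.1 = i + 1 ↔ v.1 - 1 = i := fun i => sub_eq_iff_eq_add.symm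
      rw [Fintype.sum_prod_type, sum_comm]
      simp only [F, h, sum_ite_eq, mem_univ, if_true]
      rw [hgcol, sub_add_cancel])
    (fun u => hload _ _)
  have hmove : ∀ u, 0 < F u (σ u) → (σ u).1 = u.1 + 1 ∧ 0 < g u.1 u.2 (σ u).2 := by
    intro u hu
    simp only [F] at hu
    split_ifs at hu with h
    · exact ⟨h, hu⟩
    · exact absurd hu (lt_irrefl _)
  have hpath : ∀ a ∈ A, ∀ i ≤ n, (((σ ^ i) (0, a)).1 : ℕ) = i ∧
      0 < F ((σ ^ i) (0, a)) (σ ((σ ^ i) (0, a))) := by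
    intro a ha i
    induction i with
    | zero =>
      intro _
      refine ⟨by simp, ?_⟩
      rcases hσ (0, a) with h | ⟨-, h⟩
      · simpa using h
      · simp [hA, ha] at h
    | succ i ih =>
      intro hi
      obtain ⟨hlay, hpos⟩ := ih (by omega)
      obtain ⟨hlay', -⟩ := hmove _ hpos
      have hval : ((σ ((σ ^ i) (0, a))).1 : ℕ) = i + 1 := by
        rw [hlay', hsucc _ (by omega), hlay]
      rw [pow_succ', Equiv.Perm.mul_apply]
      refine ⟨hval, ?_⟩
      rcases hσ (σ ((σ ^ i) (0, a))) with h | ⟨h, -⟩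
      · exact h
      · rw [σ.injective h, hlay] at hval
        omega
  refine ⟨fun a i => ((σ ^ i) (0, a)).2, by simp, fun a ha i hi => ?_, fun a ha => ?_,
    fun a ha a' ha' hne i hi heq => hne ?_⟩
  · obtain ⟨hlay, hpos⟩ := hpath a ha i hi.le
    have h := (hmove _ hpos).2
    simp only [g, hlay, hi.ne, if_false] at h
    simpa only [pow_succ', Equiv.Perm.mul_apply] using h
  · obtain ⟨hlay, hpos⟩ := hpath a ha n le_rfl
    have h := (hmove _ hpos).2
    simp only [g, hlay, if_true] at h
    by_contra hb
    simp [hb] at h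
  · have h : (σ ^ i) (0, a) = (σ ^ i) (0, a') :=
      Prod.ext (Fin.ext ((hpath a ha i hi).1.trans (hpath a' ha' i hi).1.symm)) heq
    exact (Prod.ext_iff.1 ((σ ^ i).injective h)).2

namespace BStr

/-- The transition kernel on strings that resamples bit `i` uniformly. -/
noncomputable def flipKernel {d : ℕ} (i : ℕ) (b b' : BStr d) : ℝ :=
  if ∀ j : Fin d, (j : ℕ) ≠ i → b j = b' j then 1 / 2 else 0

variable {d : ℕ}

theorem flipKernel_nonneg (i : ℕ) (b b' : BStr d) : 0 ≤ flipKernel i b b' := by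
  unfold flipKernel
  split_ifs <;> norm_num

theorem flipKernel_comm (i : ℕ) (b b' : BStr d) : flipKernel i b b' = flipKernel i b' b := by
  simp only [flipKernel, eq_comm]

theorem agree_of_flipKernel_pos {i : ℕ} {b b' : BStr d} (h : 0 < flipKernel i b b') :
    ∀ j : Fin d, (j : ℕ) ≠ i → b j = b' j := by
  unfold flipKernel at h
  split_ifs at h with h'
  · exact h'
  · exact absurd h (lt_irrefl _)

theorem sum_flipKernel_mul (i : Fin d) (b : BStr d) (g : BStr d → ℝ) :
    ∑ x, flipKernel i b x * g x =
      (g (Function.update b i true) + g (Function.update b i false)) / 2 := by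
  have hne : Function.update b i true ≠ Function.update b i false := fun h => by
    simpa using congrFun h i
  have hsub : ∑ x ∈ {Function.update b i true, Function.update b i false},
      flipKernel i b x * g x = ∑ x, flipKernel i b x * g x := by
    refine Finset.sum_subset (Finset.subset_univ _) fun x _ hx => ?_
    rw [flipKernel, if_neg, zero_mul]
    intro h
    refine hx ?_
    have hx' : x = Function.update b i (x i) := by
      ext j
      by_cases hj : j = i
      · simp [hj]
      · simp [hj, h j (fun e => hj (Fin.ext e))]
    cases hxi : x i <;> rw [hxi] at hx' <;> simp [← hx']
  have hval : ∀ v, flipKernel i b (Function.update b i v) = 1 / 2 := fun v => by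
    rw [flipKernel, if_pos]
    intro j hj
    rw [Function.update_of_ne (fun e => hj (by rw [e]))]
  rw [← hsub, Finset.sum_pair hne, hval, hval]
  ring

theorem sum_flipKernel (i : Fin d) (b : BStr d) : ∑ x, flipKernel i b x = 1 := by
  simpa using sum_flipKernel_mul i b fun _ => 1

/-- The function obtained from `g` by successively averaging over the bits `c 0, …, c (k - 1)`. -/
noncomputable def spread (c : ℕ → ℕ) (g : BStr d → ℝ) : ℕ → BStr d → ℝ
  | 0 => g
  | k + 1 => fun b => ∑ x, flipKernel (c k) b x * spread c g k x

theorem spread_nonneg (c : ℕ → ℕ) {g : BStr d → ℝ} (hg : ∀ b, 0 ≤ g b) (k : ℕ) (b : BStr d) :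
    0 ≤ spread c g k b := by
  induction k generalizing b with
  | zero => exact hg b
  | succ k ih => exact Finset.sum_nonneg fun x _ => mul_nonneg (flipKernel_nonneg _ _ _) (ih x)

theorem spread_le_one {c : ℕ → ℕ} (hc : ∀ k < d, c k < d) {g : BStr d → ℝ} (hg : ∀ b, g b ≤ 1)
    {k : ℕ} (hk : k ≤ d) (b : BStr d) : spread c g k b ≤ 1 := by
  induction k generalizing b with
  | zero => exact hg b
  | succ k ih =>
    calc spread c g (k + 1) b
        ≤ ∑ x, flipKernel (c k) b x * 1 := Finset.sum_le_sum fun x _ =>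
          mul_le_mul_of_nonneg_left (ih (by omega) x) (flipKernel_nonneg _ _ _)
      _ = 1 := by
        simpa using sum_flipKernel ⟨c k, hc k hk⟩ b

theorem sum_spread {c : ℕ → ℕ} (hc : ∀ k < d, c k < d) (g : BStr d → ℝ)
    {k : ℕ} (hk : k ≤ d) : ∑ b, spread c g k b = ∑ b, g b := by
  induction k with
  | zero => rfl
  | succ k ih =>
    rw [← ih (by omega)]
    simp only [spread]
    rw [Finset.sum_comm]
    refine Finset.sum_congr rfl fun x _ => ?_
    simp only [flipKernel_comm (c k) _ x, ← Finset.sum_mul]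
    rw [sum_flipKernel ⟨c k, hc k hk⟩, one_mul]

theorem spread_congr {c : ℕ → ℕ} (hc : ∀ k < d, c k < d) (g : BStr d → ℝ)
    {k : ℕ} (hk : k ≤ d) {b b' : BStr d}
    (h : ∀ j : Fin d, (∀ l < k, c l ≠ j) → b j = b' j) :
    spread c g k b = spread c g k b' := by
  induction k generalizing b b' with
  | zero => rw [funext fun j => h j (by simp)]
  | succ k ih =>
    have hupd : ∀ v, spread c g k (Function.update b ⟨c k, hc k hk⟩ v) =
        spread c g k (Function.update b' ⟨c k, hc k hk⟩ v) := by
      intro v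
      refine ih (by omega) fun j hj => ?_
      by_cases hjk : j = ⟨c k, hc k hk⟩
      · simp [hjk]
      · rw [Function.update_of_ne hjk, Function.update_of_ne hjk]
        refine h j fun l hl => ?_
        rcases Nat.lt_succ_iff_lt_or_eq.1 hl with hl | rfl
        · exact hj l hl
        · exact fun e => hjk (Fin.ext e.symm)
    have hsum := fun x => sum_flipKernel_mul ⟨c k, hc k hk⟩ x (spread c g k)
    simp only [spread]
    rw [hsum, hsum, hupd, hupd]

theorem spread_full {c : ℕ → ℕ} (hc : ∀ k < d, c k < d) (hsurj : ∀ j < d, ∃ k < d, c k = j)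
    (g : BStr d → ℝ) (b : BStr d) : spread c g d b = (∑ x, g x) / 2 ^ d := by
  have hconst : ∀ x, spread c g d x = spread c g d b := fun x =>
    spread_congr hc g le_rfl fun j hj => by
      obtain ⟨k, hk, hkj⟩ := hsurj j j.2
      exact absurd hkj (hj k hk)
  rw [← sum_spread hc g le_rfl]
  simp [hconst]

end BStr

open BStr Finset in
/-- A pair of butterflies routes any input set to any output set of the same size,
node-disjointly. -/
theorem exists_isPathSystemOn_pairAdj (d : ℕ) (τ : BStr d ≃ BStr d)
    (A B : Finset (BStr d)) (hAB : #A = #B) :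
    ∃ P : BStr d → Fin (2*d+1) → BStr d, IsPathSystemOn d (pairAdj d τ) A B P := by
  let c : ℕ → ℕ := fun k => d - 1 - k
  have hid : ∀ k < d, id k < d := fun k hk => hk
  have hc : ∀ k < d, c k < d := fun k hk => by simp only [c]; omega
  let ind : Finset (BStr d) → BStr d → ℝ := fun S b => if b ∈ S then 1 else 0
  have hind0 : ∀ S b, 0 ≤ ind S b := fun S b => by simp only [ind]; split_ifs <;> norm_num
  have hind1 : ∀ S b, ind S b ≤ 1 := fun S b => by simp only [ind]; split_ifs <;> norm_num
  let L : ℕ → BStr d → ℝ := spread id (ind A)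
  let R : ℕ → BStr d → ℝ := spread c (ind B)
  have hmid : ∀ b b', L d b = R d b' := fun b b' => by
    simp only [L, R]
    rw [spread_full hid (fun j hj => ⟨j, hj, rfl⟩),
      spread_full hc (fun j hj => ⟨d - 1 - j, by omega, by simp only [c]; omega⟩)]
    simp [ind, hAB]
  let lab : ℕ → BStr d ≃ BStr d := fun i => if i = d then τ.symm else Equiv.refl _
  let f : ℕ → BStr d → BStr d → ℝ := fun i u v =>
    if i < d then L i u * flipKernel i u (lab (i + 1) v)
    else flipKernel (i - d) u v * R (2 * d - (i + 1)) v
  let load : ℕ → BStr d → ℝ := fun i u => if i < d then L i u else R (2 * d - i) u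
  obtain ⟨P, hP0, hPadj, hPB, hPdisj⟩ := exists_disjoint_paths_of_layered_flow
    (2 * d) A B hAB f load
    (fun i u v => by
      have := flipKernel_nonneg i u (lab (i + 1) v)
      have := flipKernel_nonneg (i - d) u v
      have : 0 ≤ L i u := spread_nonneg _ (hind0 A) _ _
      have : 0 ≤ R (2 * d - (i + 1)) v := spread_nonneg _ (hind0 B) _ _
      simp only [f]
      split_ifs <;> positivity)
    (fun i hi u => by
      by_cases hid : i < d
      · simp only [f, load, hid, if_true, ← mul_sum]
        rw [(lab (i + 1)).sum_comp (fun v => flipKernel i u v), sum_flipKernel ⟨i, hid⟩, mul_one]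
      · have hk : 2 * d - i = (2 * d - (i + 1)) + 1 := by omega
        have hbit : c (2 * d - (i + 1)) = i - d := by simp only [c]; omega
        simp only [f, load, hid, if_false, hk, R, spread, hbit])
    (fun i hi v => by
      by_cases hid : i < d
      · have h : ∑ u, f i u v = L (i + 1) (lab (i + 1) v) := by
          simp only [f, hid, if_true, L, spread, id, flipKernel_comm i _ (lab (i + 1) v)]
          exact sum_congr rfl fun _ _ => mul_comm _ _
        rw [h]
        by_cases hd : i + 1 = d
        · simp only [load, hd, lt_irrefl, if_false]
          rw [show 2 * d - d = d by omega]
          exact hmid _ _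
        · have : i + 1 < d := by omega
          simp [load, lab, hd, this]
      · have : ¬ i + 1 < d := by omega
        simp only [f, load, hid, this, if_false, ← sum_mul, flipKernel_comm (i - d) _ v]
        rw [sum_flipKernel ⟨i - d, by omega⟩, one_mul])
    (fun i u => by
      by_cases hi : i < d
      · simp only [load, hi, if_true]
        exact spread_le_one hid (hind1 A) hi.le u
      · simp only [load, hi, if_false]
        exact spread_le_one hc (hind1 B) (by omega) u)
    (fun u => by
      rcases d.eq_zero_or_pos with h | h
      · have := hmid u u
        subst h
        simpa [load, L, R, spread, ind] using this.symm
      · simp [load, h, L, spread, ind])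
    (fun u => by
      have : ¬ 2 * d < d := by omega
      simp [load, this, R, spread, ind])
  refine ⟨fun a i => P a i, fun a ha => hP0 a ha, fun a ha i => ?_, fun a ha => hPB a ha, ?_,
    fun a ha a' ha' hne i => hPdisj a ha a' ha' hne i (by omega)⟩
  · have hpos := hPadj a ha i i.2
    refine ⟨by simp, ?_⟩
    simp only [Fin.val_castSucc, Fin.val_succ]
    by_cases hid : (i : ℕ) < d
    · simp only [f, hid, if_true] at hpos
      have hag := agree_of_flipKernel_pos
        (pos_of_mul_pos_right hpos (spread_nonneg _ (hind0 A) _ _))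
      by_cases hd : (i : ℕ) + 1 = d
      · refine Or.inr (Or.inl ⟨hd, ?_⟩)
        simpa only [lab, hd, if_true] using hag
      · refine Or.inl ⟨by omega, ?_⟩
        simpa only [lab, hd, if_false, Equiv.refl_apply] using hag
    · simp only [f, hid, if_false] at hpos
      exact Or.inr (Or.inr ⟨by omega, agree_of_flipKernel_pos
        (pos_of_mul_pos_left hpos (spread_nonneg _ (hind0 B) _ _))⟩)
  · have hinj : Set.InjOn (fun a => P a (2 * d)) A := fun a ha a' ha' h => by
      by_contra hne
      exact hPdisj a ha a' ha' hne _ le_rfl h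
    intro b hb
    obtain ⟨a, ha, hab⟩ := surj_on_of_inj_on_of_card_le (fun a _ => P a (2 * d)) hPB
      (fun a a' ha ha' h => hinj ha ha' h) hAB.ge b hb
    exact ⟨a, ha, hab.symm⟩

/-- a pair of `d`-dimensional butterflies routes any input set `A`
to any output set `B` with `|A| = |B| = 2^d - 2^m`, `m ≤ d`, node-disjointly. -/
theorem pair_of_butterflies_complement_pow_two_concentrator
    (d m : ℕ) (hm : m ≤ d) (τ : BStr d ≃ BStr d)
    (A B : Finset (BStr d))
    (hA : A.card = 2 ^ d - 2 ^ m) (hB : B.card = 2 ^ d - 2 ^ m) :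
    ∃ P : BStr d → Fin (2*d+1) → BStr d,
      IsPathSystemOn d (pairAdj d τ) A B P := by
  exact exists_isPathSystemOn_pairAdj d τ A B (hA.trans hB.symm)
end

section
/- Let G be a pair of d-dimensional butterflies such that for every node u on layer ⌊d/2⌋ and every node v on layer 2d − ⌊d/2⌋ there is a directed path in G from u to v. Then for every set A of input nodes and set B of output nodes with |A| = |B| ≤ 2^{⌊d/2⌋} and every bijection ρ : A → B, there exists a collection of |A| node-disjoint directed paths such that for every a ∈ A one of the paths runs from a to ρ(a). -/
/-- The rank of `a` in `A`, with respect to the binary value of strings whose lowest bit is bit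
`0`. -/
def butterflyRank {d : ℕ} (A : Finset (BStr d)) (a : BStr d) : ℕ :=
  (A.filter fun x => Nat.ofBits x < Nat.ofBits a).card

lemma ofBits_injective {d : ℕ} {a b : BStr d} (h : Nat.ofBits a = Nat.ofBits b) : a = b := by
  funext j
  have := congrArg (fun n => n.testBit j) h
  simpa [Nat.testBit_ofBits_lt] using this

lemma butterflyRank_lt_card {d : ℕ} {A : Finset (BStr d)} {a : BStr d} (ha : a ∈ A) :
    butterflyRank A a < A.card := by
  apply Finset.card_lt_card
  rw [Finset.filter_ssubset]
  exact ⟨a, ha, lt_irrefl _⟩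

lemma butterflyRank_lt {d : ℕ} {A : Finset (BStr d)} {a b : BStr d} (ha : a ∈ A)
    (h : Nat.ofBits a < Nat.ofBits b) : butterflyRank A a < butterflyRank A b := by
  apply Finset.card_lt_card
  rw [Finset.ssubset_iff_of_subset]
  · exact ⟨a, by simp [ha, h], by simp⟩
  · intro x hx
    simp only [Finset.mem_filter] at hx ⊢
    exact ⟨hx.1, hx.2.trans h⟩

lemma butterflyRank_le {d : ℕ} (A : Finset (BStr d)) (a b : BStr d) :
    butterflyRank A b ≤ butterflyRank A a + (Nat.ofBits b - Nat.ofBits a) := by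
  have hsub : A.filter (fun x => Nat.ofBits x < Nat.ofBits b) ⊆
      A.filter (fun x => Nat.ofBits x < Nat.ofBits a) ∪
        A.filter (fun x => Nat.ofBits x ∈ Finset.Ico (Nat.ofBits a) (Nat.ofBits b)) := by
    intro x hx
    simp only [Finset.mem_filter, Finset.mem_union, Finset.mem_Ico] at hx ⊢
    by_cases hxa : Nat.ofBits x < Nat.ofBits a
    · exact Or.inl ⟨hx.1, hxa⟩
    · exact Or.inr ⟨hx.1, by omega, hx.2⟩
  have hcard : (A.filter fun x => Nat.ofBits x ∈ Finset.Ico (Nat.ofBits a) (Nat.ofBits b)).card ≤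
      Nat.ofBits b - Nat.ofBits a := by
    rw [← Nat.card_Ico]
    refine Finset.card_le_card_of_injOn Nat.ofBits (fun x hx => ?_)
      fun x _ y _ hxy => ofBits_injective hxy
    simp only [Finset.coe_filter, Set.mem_ofPred_eq] at hx
    exact hx.2
  exact (Finset.card_le_card hsub).trans ((Finset.card_union_le _ _).trans (by
    unfold butterflyRank; omega))

lemma ofBits_div_two_pow_eq {d i : ℕ} {a b : BStr d} (h : ∀ j : Fin d, i ≤ (j : ℕ) → a j = b j) :
    Nat.ofBits a / 2 ^ i = Nat.ofBits b / 2 ^ i := by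
  apply Nat.eq_of_testBit_eq
  intro j
  rw [Nat.testBit_div_two_pow, Nat.testBit_div_two_pow]
  by_cases hj : j + i < d
  · rw [Nat.testBit_ofBits_lt _ _ hj, Nat.testBit_ofBits_lt _ _ hj]
    exact h _ (by simp)
  · rw [Nat.testBit_ofBits_ge _ _ (by omega), Nat.testBit_ofBits_ge _ _ (by omega)]

lemma mod_two_pow_eq_of_testBit {d i m n : ℕ} (hi : i ≤ d)
    (h : ∀ j : Fin d, (j : ℕ) < i → m.testBit j = n.testBit j) : m % 2 ^ i = n % 2 ^ i := by
  apply Nat.eq_of_testBit_eq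
  intro j
  rw [Nat.testBit_mod_two_pow, Nat.testBit_mod_two_pow]
  by_cases hj : j < i
  · simp [h ⟨j, by omega⟩ hj]
  · simp [hj]

lemma butterflyRank_mod_ne {d i : ℕ} {A : Finset (BStr d)} {a b : BStr d} (ha : a ∈ A)
    (hlt : Nat.ofBits a < Nat.ofBits b) (hdiv : Nat.ofBits a / 2 ^ i = Nat.ofBits b / 2 ^ i) :
    butterflyRank A a % 2 ^ i ≠ butterflyRank A b % 2 ^ i := by
  intro hmod
  have h1 := butterflyRank_lt ha hlt
  have h2 := butterflyRank_le A a b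
  have hdvd : 2 ^ i ∣ butterflyRank A b - butterflyRank A a :=
    (Nat.modEq_iff_dvd' h1.le).1 hmod
  have h3 := Nat.le_of_dvd (by omega) hdvd
  have h4 := Nat.div_add_mod (Nat.ofBits a) (2 ^ i)
  have h5 := Nat.div_add_mod (Nat.ofBits b) (2 ^ i)
  have h6 := Nat.mod_lt (Nat.ofBits b) (Nat.two_pow_pos i)
  rw [hdiv] at h4
  omega

/-- Any set of at most `2 ^ k` inputs of a butterfly can be routed through the first `k` layers by
node-disjoint paths whose endpoints have pairwise distinct first `k` bits. -/
lemma exists_concentration {d k : ℕ} (hk : k ≤ d) (A : Finset (BStr d)) (hA : A.card ≤ 2 ^ k) :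
    ∃ p : BStr d → BStr d, ∀ a ∈ A, ∀ b ∈ A, a ≠ b →
      (∃ j : Fin d, (j : ℕ) < k ∧ p a j ≠ p b j) ∧
      ∀ i ≤ k, ∃ j : Fin d, if (j : ℕ) < i then p a j ≠ p b j else a j ≠ b j := by
  refine ⟨fun a j => (butterflyRank A a).testBit j, fun a ha b hb hab => ⟨?_, fun i hi => ?_⟩⟩
  · by_contra! h
    have hmod := mod_two_pow_eq_of_testBit hk h
    rw [Nat.mod_eq_of_lt ((butterflyRank_lt_card ha).trans_le hA),
      Nat.mod_eq_of_lt ((butterflyRank_lt_card hb).trans_le hA)] at hmod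
    rcases lt_trichotomy (Nat.ofBits a) (Nat.ofBits b) with hlt | heq | hlt
    · exact (butterflyRank_lt ha hlt).ne hmod
    · exact hab (ofBits_injective heq)
    · exact (butterflyRank_lt hb hlt).ne hmod.symm
  · by_contra! h
    have hmod : butterflyRank A a % 2 ^ i = butterflyRank A b % 2 ^ i :=
      mod_two_pow_eq_of_testBit (hi.trans hk) fun j hj => by simpa [hj] using h j
    have hdiv : Nat.ofBits a / 2 ^ i = Nat.ofBits b / 2 ^ i :=
      ofBits_div_two_pow_eq fun j hj => by simpa [not_lt.2 hj] using h j
    rcases lt_trichotomy (Nat.ofBits a) (Nat.ofBits b) with hlt | heq | hlt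
    · exact butterflyRank_mod_ne ha hlt hdiv hmod
    · exact hab (ofBits_injective heq)
    · exact butterflyRank_mod_ne hb hlt hdiv.symm hmod.symm

/-- The mirror image of `exists_concentration`: the bits are processed from the last one down. -/
lemma exists_concentration_rev {d k : ℕ} (hk : k ≤ d) (B : Finset (BStr d))
    (hB : B.card ≤ 2 ^ k) :
    ∃ q : BStr d → BStr d, ∀ a ∈ B, ∀ b ∈ B, a ≠ b →
      (∃ j : Fin d, d - k ≤ (j : ℕ) ∧ q a j ≠ q b j) ∧
      ∀ i, d - k ≤ i → i ≤ d →
        ∃ j : Fin d, if (j : ℕ) < i then a j ≠ b j else q a j ≠ q b j := by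
  obtain ⟨p, hp⟩ := exists_concentration hk (B.image fun a => a ∘ Fin.rev)
    (Finset.card_image_le.trans hB)
  refine ⟨fun a => p (a ∘ Fin.rev) ∘ Fin.rev, fun a ha b hb hab => ?_⟩
  have hne : a ∘ Fin.rev ≠ b ∘ Fin.rev := fun h =>
    hab (Fin.rev_surjective.injective_comp_right h)
  obtain ⟨⟨j, hj, hpj⟩, h⟩ := hp _ (Finset.mem_image_of_mem _ ha) _
    (Finset.mem_image_of_mem _ hb) hne
  refine ⟨⟨j.rev, by rw [Fin.val_rev]; omega, by simpa using hpj⟩, fun i hi hid => ?_⟩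
  obtain ⟨j, hj⟩ := h (d - i) (by omega)
  refine ⟨j.rev, ?_⟩
  have hiff : (j.rev : ℕ) < i ↔ ¬ (j : ℕ) < d - i := by
    rw [Fin.val_rev]; omega
  by_cases hji : (j : ℕ) < d - i
  · rw [if_neg fun h => hiff.1 h hji]
    simpa [hji] using hj
  · rw [if_pos (hiff.2 hji)]
    simpa [hji] using hj

/-- A node reachable from `(k, b)` either lies in the left butterfly and shares its first `k` bits
with `b`, or is reached through a middle node with this property. -/
lemma reachable_invariant {d k : ℕ} {τ : BStr d ≃ BStr d} {b : BStr d} (hk : k < 2 * d + 1)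
    (hkd : k < d ∨ d = 0) {v : Fin (2 * d + 1) × BStr d}
    (h : Relation.ReflTransGen (pairAdj d τ) (⟨k, hk⟩, b) v) :
    k ≤ (v.1 : ℕ) ∧
    ((v.1 : ℕ) < d → ∀ j : Fin d, (j : ℕ) < k → v.2 j = b j) ∧
    (d ≤ (v.1 : ℕ) → ∃ m : BStr d, (∀ j : Fin d, (j : ℕ) < k → m j = b j) ∧
      ∀ j : Fin d, (v.1 : ℕ) - d ≤ (j : ℕ) → τ m j = v.2 j) := by
  induction h with
  | refl =>
    refine ⟨le_rfl, fun _ _ _ => rfl, fun hdk => ⟨b, fun _ _ => rfl, fun j => ?_⟩⟩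
    have := j.isLt
    have : d ≤ k := hdk
    omega
  | @tail u v _ huv ih =>
    obtain ⟨hku, hlow, hhigh⟩ := ih
    obtain ⟨hlayer, huv⟩ := huv
    refine ⟨by omega, fun hvd j hj => ?_, fun hvd => ?_⟩
    · rcases huv with ⟨_, huv⟩ | ⟨_, _⟩ | ⟨_, _⟩
      · rw [← huv j (by omega), hlow (by omega) j hj]
      · omega
      · omega
    · rcases huv with ⟨_, _⟩ | ⟨hv, huv⟩ | ⟨hu, huv⟩
      · omega
      · refine ⟨τ.symm v.2, fun j hj => ?_, fun j _ => by simp⟩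
        rw [← huv j (by omega), hlow (by omega) j hj]
      · obtain ⟨m, hm, hτ⟩ := hhigh hu
        refine ⟨m, hm, fun j hj => ?_⟩
        rw [hτ j (by omega), huv j (by omega)]

/-- if in a pair of `d`-dimensional butterflies every node on layer
`⌊d/2⌋` can reach every node on layer `2d - ⌊d/2⌋` by a directed path, then any
bijection `ρ` from an input set `A` to an output set `B` with
`|A| = |B| ≤ 2^⌊d/2⌋` can be routed by node-disjoint paths, the path starting
at `a` ending at `ρ a`. -/
theorem pair_of_butterflies_small_rearrangeable
    (d : ℕ) (τ : BStr d ≃ BStr d)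
    (hconn : ∀ b c : BStr d,
      Relation.ReflTransGen (pairAdj d τ)
        ((⟨d / 2, by omega⟩ : Fin (2*d+1)), b)
        ((⟨2*d - d / 2, by omega⟩ : Fin (2*d+1)), c))
    (A B : Finset (BStr d)) (hAB : A.card = B.card)
    (hsize : A.card ≤ 2 ^ (d / 2))
    (ρ : BStr d → BStr d) (hρ : Set.BijOn ρ ↑A ↑B) :
    ∃ P : BStr d → Fin (2*d+1) → BStr d,
      (∀ a ∈ A, P a 0 = a) ∧
      (∀ a ∈ A, P a (Fin.last (2*d)) = ρ a) ∧
      (∀ a ∈ A, ∀ i : Fin (2*d),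
        pairAdj d τ (i.castSucc, P a i.castSucc) (i.succ, P a i.succ)) ∧
      (∀ a ∈ A, ∀ a' ∈ A, a ≠ a' → ∀ i, P a i ≠ P a' i) := by
  have hmaps : ∀ a ∈ A, ρ a ∈ B := fun a ha => hρ.mapsTo ha
  obtain ⟨p, hp⟩ := exists_concentration (by omega) A hsize
  obtain ⟨q, hq⟩ := exists_concentration_rev (k := d / 2) (by omega) B (hAB ▸ hsize)
  have hmid : ∀ a, ∃ m : BStr d, (∀ j : Fin d, (j : ℕ) < d / 2 → m j = p a j) ∧
      ∀ j : Fin d, d - d / 2 ≤ (j : ℕ) → τ m j = q (ρ a) j := fun a => by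
    obtain ⟨m, hm, hτ⟩ := (reachable_invariant (by omega) (by omega)
      (hconn (p a) (q (ρ a)))).2.2 (by dsimp only; omega)
    exact ⟨m, hm, fun j hj => hτ j (by dsimp only; omega)⟩
  choose m hm hτ using hmid
  refine ⟨fun a t j => if (t : ℕ) < d then (if (j : ℕ) < t then m a j else a j)
    else (if (j : ℕ) < t - d then ρ a j else τ (m a) j), ?_, ?_, ?_, ?_⟩
  · intro a _
    funext j
    simp [j.pos]
  · intro a _
    funext j
    have h1 : ¬ 2 * d < d := by omega
    have h2 : (j : ℕ) < 2 * d - d := by omega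
    simp [h1, h2]
  · intro a _ i
    refine ⟨by simp, ?_⟩
    simp only [Fin.val_castSucc, Fin.val_succ]
    rcases lt_trichotomy ((i : ℕ) + 1) d with hi | hi | hi
    · refine Or.inl ⟨hi, fun j hj => ?_⟩
      rw [if_pos (by omega), if_pos hi]
      exact if_congr (by omega) rfl rfl
    · refine Or.inr (Or.inl ⟨hi, fun j hj => ?_⟩)
      have h0 : (fun j : Fin d => if (i : ℕ) + 1 < d then
          (if (j : ℕ) < i + 1 then m a j else a j)
          else (if (j : ℕ) < i + 1 - d then ρ a j else τ (m a) j)) = τ (m a) := by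
        funext j
        rw [if_neg (by omega), if_neg (by omega)]
      rw [h0, if_pos (by omega), if_pos (by omega), Equiv.symm_apply_apply]
    · refine Or.inr (Or.inr ⟨by omega, fun j hj => ?_⟩)
      rw [if_neg (show ¬ (i : ℕ) < d by omega), if_neg (show ¬ (i : ℕ) + 1 < d by omega)]
      exact if_congr (by omega) rfl rfl
  · intro a ha b hb hab t heq
    obtain ⟨⟨j₁, hj₁, hpj⟩, hpath⟩ := hp a ha b hb hab
    obtain ⟨⟨j₂, hj₂, hqj⟩, hqath⟩ := hq _ (hmaps a ha) _ (hmaps b hb)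
      fun h => hab (hρ.injOn ha hb h)
    by_cases htd : (t : ℕ) < d
    · simp only [htd, if_true] at heq
      by_cases htk : (t : ℕ) ≤ d / 2
      · obtain ⟨j, hj⟩ := hpath t htk
        have hj' := congrFun heq j
        by_cases hjt : (j : ℕ) < t
        · simp only [hjt, if_true, hm _ j (hjt.trans_le htk)] at hj hj'
          exact hj hj'
        · simp only [hjt, if_false] at hj hj'
          exact hj hj'
      · have hj' := congrFun heq j₁
        simp only [show (j₁ : ℕ) < t by omega, if_true, hm _ j₁ hj₁] at hj'
        exact hpj hj'
    · simp only [htd, if_false] at heq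
      by_cases htk : d - d / 2 ≤ t - d
      · obtain ⟨j, hj⟩ := hqath (t - d) htk (by omega)
        have hj' := congrFun heq j
        by_cases hjt : (j : ℕ) < t - d
        · simp only [hjt, if_true] at hj hj'
          exact hj hj'
        · simp only [hjt, if_false, hτ _ j (by omega)] at hj hj'
          exact hj hj'
      · have hj' := congrFun heq j₂
        simp only [show ¬ (j₂ : ℕ) < t - d by omega, if_false, hτ _ j₂ hj₂] at hj'
        exact hqj hj'
end

section
/- Let G be a pair of d-dimensional layer-permuted butterflies with left layer permutation π and right layer permutation σ. Suppose π(i) ≤ ⌊d/2⌋ whenever i ≤ ⌊d/2⌋, and σ(i) ≥ ⌈d/2⌉ whenever i ≥ ⌈d/2⌉. Then for every set A of input nodes and set B of output nodes with |A| = |B| ≤ 2^{⌊d/2⌋} and every bijection ρ : A → B, there exists a collection of |A| node-disjoint directed paths such that for every a ∈ A one of the paths runs from a to ρ(a). -/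
/-- Adjacency relation of a pair of `d`-dimensional layer-permuted butterflies
(left layer permutation `π`, right layer permutation `σ`, both written
`0`-based: the edge-layer between node-layers `i` and `i+1` of a butterfly may
change bit `π i`, resp. `σ (i - d)`).  A node is a pair (layer, string) with
layers `0,…,2d`; output node `b` of the left butterfly is identified with input
node `b` of the right butterfly. -/
def lpPairAdj (d : ℕ) (π σ : Equiv.Perm (Fin d))
    (u v : Fin (2*d+1) × BStr d) : Prop :=
  (u.1 : ℕ) + 1 = (v.1 : ℕ) ∧
  ((∃ h : (u.1 : ℕ) < d,
      ∀ j : Fin d, j ≠ π ⟨(u.1 : ℕ), h⟩ → u.2 j = v.2 j) ∨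
   (∃ h : (u.1 : ℕ) - d < d, d ≤ (u.1 : ℕ) ∧
      ∀ j : Fin d, j ≠ σ ⟨(u.1 : ℕ) - d, h⟩ → u.2 j = v.2 j))

/-- Two involutions admit a common two-colouring in which every non-fixed point gets a colour
different from its image under either involution. -/
theorem exists_bool_coloring_of_involutive {ι : Type*} {e₁ e₂ : ι → ι}
    (h₁ : Function.Involutive e₁) (h₂ : Function.Involutive e₂) :
    ∃ γ : ι → Bool, (∀ a, e₁ a ≠ a → γ (e₁ a) ≠ γ a) ∧ (∀ a, e₂ a ≠ a → γ (e₂ a) ≠ γ a) := by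
  classical
  -- Doubling `ι` turns both involutions into fixed-point-free ones.
  let lift (e : ι → ι) : ι × Bool → ι × Bool :=
    fun x => if e x.1 = x.1 then (x.1, !x.2) else (e x.1, x.2)
  have lift_inv (e : ι → ι) (he : Function.Involutive e) : Function.Involutive (lift e) := by
    rintro ⟨a, s⟩
    by_cases h : e a = a
    · simp [lift, h]
    · have h' : a ≠ e a := fun h' => h h'.symm
      simp [lift, h, he a, h']
  have lift_ne (e : ι → ι) (x : ι × Bool) : lift e x ≠ x := by
    obtain ⟨a, s⟩ := x
    by_cases h : e a = a <;> simp [lift, h]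
  let f₁ : Equiv.Perm (ι × Bool) := (lift_inv e₁ h₁).toPerm
  let f₂ : Equiv.Perm (ι × Bool) := (lift_inv e₂ h₂).toPerm
  have f₁_inv (x) : f₁ (f₁ x) = x := lift_inv e₁ h₁ x
  have f₂_inv (x) : f₂ (f₂ x) = x := lift_inv e₂ h₂ x
  have f₁_ne (x) : f₁ x ≠ x := lift_ne e₁ x
  have f₂_ne (x) : f₂ x ≠ x := lift_ne e₂ x
  let τ : Equiv.Perm (ι × Bool) := f₁ * f₂
  have conj_eq : f₁ * τ * f₁⁻¹ = τ⁻¹ := by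
    have hf₁ : f₁⁻¹ = f₁ := by
      ext1 x; rw [Equiv.Perm.inv_eq_iff_eq, f₁_inv]
    have hf₂ : f₂⁻¹ = f₂ := by
      ext1 x; rw [Equiv.Perm.inv_eq_iff_eq, f₂_inv]
    have h : f₁ * f₁ = 1 := by ext1 x; exact f₁_inv x
    simp only [τ, mul_inv_rev, hf₁, hf₂, ← mul_assoc, h, one_mul]
  have f₁_zpow (n : ℤ) (x) : f₁ ((τ ^ n) x) = (τ ^ (-n)) (f₁ x) := by
    have h : f₁ * τ ^ n * f₁⁻¹ = τ ^ (-n) := by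
      rw [← conj_zpow, conj_eq, inv_zpow']
    rw [← h]; simp
  have not_same (x) : ¬ τ.SameCycle x (f₁ x) := by
    rintro ⟨n, hn⟩
    obtain ⟨j, rfl | rfl⟩ := Int.even_or_odd' n
    · apply f₁_ne ((τ ^ j) x)
      rw [f₁_zpow, ← hn, ← Equiv.Perm.mul_apply, ← zpow_add]
      congr 2; ring
    · apply f₂_ne ((τ ^ j) x)
      have h : f₁ ((τ ^ j) x) = (τ ^ (j + 1)) x := by
        rw [f₁_zpow, ← hn, ← Equiv.Perm.mul_apply, ← zpow_add]
        congr 2; ring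
      apply f₁.injective
      rw [h, add_comm, zpow_add, zpow_one]
      rfl
  let Q := Quotient (Equiv.Perm.SameCycle.setoid τ)
  let g : Q → Q := Quotient.map f₁ (by
    rintro x y ⟨n, rfl⟩
    exact ⟨-n, (f₁_zpow n x).symm⟩)
  have g_mk (x) : g (Quotient.mk _ x) = Quotient.mk _ (f₁ x) := rfl
  have g_mk₂ (x) : g (Quotient.mk _ x) = Quotient.mk _ (f₂ x) := by
    rw [g_mk]
    refine Quotient.sound ⟨-1, ?_⟩
    have : f₁ x = τ (f₂ x) := by simp [τ, f₂_inv]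
    rw [this]; simp
  have g_inv (q) : g (g q) = q := by
    induction q using Quotient.inductionOn with
    | h x => rw [g_mk, g_mk, f₁_inv]
  have g_ne (q) : g q ≠ q := by
    induction q using Quotient.inductionOn with
    | h x =>
      rw [g_mk]
      intro h
      exact not_same x (Quotient.exact h.symm)
  let _ : LinearOrder Q := linearOrderOfSTO WellOrderingRel
  let col : Q → Bool := fun q => decide (q < g q)
  have col_ne (q) : col (g q) ≠ col q := by
    simp only [col, g_inv, ne_eq, decide_eq_decide]
    rcases lt_or_gt_of_ne (g_ne q) with h | h
    · simp [h, h.not_gt]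
    · simp [h, h.not_gt]
  have key (e : ι → ι) (hg : ∀ x, g (Quotient.mk _ x) = Quotient.mk _ (lift e x))
      (a : ι) (ha : e a ≠ a) :
      col (Quotient.mk _ (e a, false)) ≠ col (Quotient.mk _ (a, false)) := by
    have h := hg (a, false)
    simp only [lift, ha, if_false] at h
    rw [← h]
    exact col_ne _
  exact ⟨fun a => col (Quotient.mk _ (a, false)), key e₁ g_mk, key e₂ g_mk₂⟩

/-- A partial matching on a finite set extends to an involution with at most one fixed point. -/
theorem exists_involutive_extending_matching {ι : Type*} [DecidableEq ι] (R : ι → ι → Prop)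
    (hsymm : ∀ a b, R a b → R b a) (S : Finset ι)
    (hfun : ∀ a ∈ S, ∀ b ∈ S, ∀ c ∈ S, R a b → R a c → b = c) (hirr : ∀ a, ¬ R a a) :
    ∃ e : ι → ι, Function.Involutive e ∧ (∀ a, e a ≠ a → a ∈ S) ∧
      (∀ a ∈ S, ∀ b ∈ S, R a b → e a = b) ∧
      (∀ a ∈ S, ∀ b ∈ S, e a = a → e b = b → a = b) := by
  induction S using Finset.strongInduction with
  | H S ih =>
  by_cases hcard : ∀ a ∈ S, ∀ b ∈ S, a = b
  · refine ⟨id, fun _ => rfl, by simp, fun a ha b hb _ => hcard a ha b hb,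
      fun a ha b hb _ _ => hcard a ha b hb⟩
  obtain ⟨x, hx, y, hy, hxy, hmax⟩ : ∃ x ∈ S, ∃ y ∈ S, x ≠ y ∧
      (R x y ∨ ∀ a ∈ S, ∀ b ∈ S, ¬ R a b) := by
    by_cases h : ∃ x ∈ S, ∃ y ∈ S, R x y
    · obtain ⟨x, hx, y, hy, h⟩ := h
      exact ⟨x, hx, y, hy, fun hxy => hirr x (by simpa [← hxy] using h), Or.inl h⟩
    · push Not at h hcard
      obtain ⟨x, hx, y, hy, hxy⟩ := hcard
      exact ⟨x, hx, y, hy, hxy, Or.inr h⟩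
  obtain ⟨e, he, hsupp, hR, hfix⟩ := ih ((S.erase x).erase y)
    ((Finset.erase_subset _ _).trans_ssubset (Finset.erase_ssubset hx))
    (fun a ha b hb c hc => hfun a (by simp_all) b (by simp_all) c (by simp_all))
  have ex : e x = x := by by_contra h; simpa using hsupp x h
  have ey : e y = y := by by_contra h; simpa using hsupp y h
  have enx (a) (h : a ≠ x) : e a ≠ x := fun h' => h (by rw [← he a, h', ex])
  have eny (a) (h : a ≠ y) : e a ≠ y := fun h' => h (by rw [← he a, h', ey])
  refine ⟨fun a => if a = x then y else if a = y then x else e a, ?_, ?_, ?_, ?_⟩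
  · intro a
    have := he a
    grind
  · intro a
    have := hsupp a
    grind
  · intro a ha b hb hab
    have := hsymm a b hab
    have := hR a
    have := hfun x hx y hy
    have := hfun y hy x hx
    have := hsymm x y
    have := hirr x
    have := hirr y
    grind
  · intro a ha b hb
    have := hfix a
    grind

/-- A two-colouring that separates the pairs of an involution with at most one fixed point is
balanced. -/
theorem card_filter_color_le {ι : Type*} [DecidableEq ι] {S : Finset ι} {e : ι → ι} {n : ℕ}
    (he : Function.Involutive e) (hsupp : ∀ a, e a ≠ a → a ∈ S)
    (hfix : ∀ a ∈ S, ∀ b ∈ S, e a = a → e b = b → a = b)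
    {γ : ι → Bool} (hγ : ∀ a, e a ≠ a → γ (e a) ≠ γ a)
    (hcard : S.card ≤ 2 ^ (n + 1)) (t : Bool) :
    (S.filter (fun a => γ a = t)).card ≤ 2 ^ n := by
  have hfixed : (S.filter (fun a => e a = a)).card ≤ 1 := by
    rw [Finset.card_le_one]
    intro a ha b hb
    simp only [Finset.mem_filter] at ha hb
    exact hfix a ha.1 b hb.1 ha.2 hb.2
  have hmoved : ((S.filter (fun a => γ a = t)).filter (fun a => ¬ e a = a)).card ≤
      (S.filter (fun a => ¬ γ a = t)).card := by
    refine Finset.card_le_card_of_injOn e ?_ he.injective.injOn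
    intro a ha
    simp only [Finset.coe_filter, Finset.mem_filter, Set.mem_ofPred_eq] at ha ⊢
    refine ⟨hsupp _ ?_, ?_⟩
    · rw [he a]; exact fun h => ha.2 h.symm
    · rw [← ha.1.2]; exact hγ a ha.2
  have hsplit := Finset.card_filter_add_card_filter_not (s := S.filter (fun a => γ a = t))
    (fun a => e a = a)
  have hle : ((S.filter (fun a => γ a = t)).filter (fun a => e a = a)).card ≤
      (S.filter (fun a => e a = a)).card :=
    Finset.card_le_card (Finset.filter_subset_filter _ (Finset.filter_subset _ _))
  have hS := Finset.card_filter_add_card_filter_not (s := S) (fun a => γ a = t)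
  rw [pow_succ] at hcard
  omega

/-- Rewriting the bits of the strings `f a` to those of `z a`, one at a time in the order given by
`l`, keeps the strings with `a ∈ S` distinct throughout, and in the end they already differ in the
rewritten bits. -/
def RoutesAlong {ι β : Type*} (l : List β) (f z : ι → β → Bool) (S : Finset ι) : Prop :=
  (∀ k, ∀ a ∈ S, ∀ b ∈ S, (∀ j ∈ l.take k, z a j = z b j) →
    (∀ j, j ∉ l.take k → f a j = f b j) → a = b) ∧
  (∀ a ∈ S, ∀ b ∈ S, (∀ j ∈ l, z a j = z b j) → a = b)

section Routing

variable {ι β : Type*}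

theorem RoutesAlong.congr {l : List β} {f z z' : ι → β → Bool} {S : Finset ι}
    (h : RoutesAlong l f z S) (hz : ∀ a ∈ S, ∀ j ∈ l, z' a j = z a j) :
    RoutesAlong l f z' S := by
  refine ⟨fun k a ha b hb hab => h.1 k a ha b hb fun j hj => ?_,
    fun a ha b hb hab => h.2 a ha b hb fun j hj => ?_⟩
  · have hj' := List.mem_of_mem_take hj
    rw [← hz a ha j hj', ← hz b hb j hj', hab j hj]
  · rw [← hz a ha j hj, ← hz b hb j hj, hab j hj]

variable [DecidableEq β]

theorem RoutesAlong.cons {p : β} {l : List β} (hp : p ∉ l) {f : ι → β → Bool} {S : Finset ι}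
    (hf : Set.InjOn f S) {γ : ι → Bool} {z : Bool → ι → β → Bool}
    (h : ∀ t, RoutesAlong l (fun a => Function.update (f a) p (γ a)) (z t)
      (S.filter (fun a => γ a = t))) :
    RoutesAlong (p :: l) f (fun a => Function.update (z (γ a) a) p (γ a)) S := by
  have hne (j) (hj : j ∈ l) : j ≠ p := fun h => hp (h ▸ hj)
  refine ⟨fun k a ha b hb hz hfe => ?_, fun a ha b hb hz => ?_⟩
  · cases k with
    | zero => exact hf ha hb (funext fun j => hfe j (by simp))
    | succ k =>
      rw [List.take_succ_cons] at hz hfe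
      have hγ : γ a = γ b := by simpa using hz p (by simp)
      refine (h (γ b)).1 k a (by simp [ha, hγ]) b (by simp [hb]) (fun j hj => ?_) fun j hj => ?_
      · simpa [hne j (List.mem_of_mem_take hj), hγ] using hz j (by simp [hj])
      · by_cases hjp : j = p
        · simp [hjp, hγ]
        · simpa [hjp] using hfe j (by simp [hjp, hj])
  · have hγ : γ a = γ b := by simpa using hz p (by simp)
    refine (h (γ b)).2 a (by simp [ha, hγ]) b (by simp [hb]) fun j hj => ?_
    simpa [hne j hj, hγ] using hz j (by simp [hj])

variable [DecidableEq ι]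

/-- An involution on `S` such that every two-colouring `γ` separating its pairs can be used as the
new value of the bit `p`: the strings stay distinct inside each of the two balanced classes. -/
theorem exists_involutive_splitting (p : β) {n : ℕ} {f : ι → β → Bool} {S : Finset ι}
    (hf : Set.InjOn f S) (hcard : S.card ≤ 2 ^ (n + 1)) :
    ∃ e : ι → ι, Function.Involutive e ∧ (∀ a, e a ≠ a → a ∈ S) ∧
      ∀ γ : ι → Bool, (∀ a, e a ≠ a → γ (e a) ≠ γ a) → ∀ t,
        (S.filter (fun a => γ a = t)).card ≤ 2 ^ n ∧
        Set.InjOn (fun a => Function.update (f a) p (γ a)) (S.filter (fun a => γ a = t)) := by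
  obtain ⟨e, he, hsupp, hR, hfix⟩ := exists_involutive_extending_matching
    (fun a b => a ≠ b ∧ ∀ j, j ≠ p → f a j = f b j)
    (fun a b h => ⟨h.1.symm, fun j hj => (h.2 j hj).symm⟩) S
    (fun a ha b hb c hc hab hac => by
      have hne {x y : ι} (hx : x ∈ S) (hy : y ∈ S)
          (h : x ≠ y ∧ ∀ j, j ≠ p → f x j = f y j) : f x p ≠ f y p := by
        intro hxy
        refine h.1 (hf hx hy (funext fun j => ?_))
        by_cases hj : j = p
        · rw [hj, hxy]
        · exact h.2 j hj
      have h₁ := hne ha hb hab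
      have h₂ := hne ha hc hac
      refine hf hb hc (funext fun j => ?_)
      by_cases hj : j = p
      · subst hj
        revert h₁ h₂
        cases f a j <;> cases f b j <;> cases f c j <;> simp
      · rw [← hab.2 j hj, hac.2 j hj])
    (fun a h => h.1 rfl)
  refine ⟨e, he, hsupp, fun γ hγ t => ⟨card_filter_color_le he hsupp hfix hγ hcard t, ?_⟩⟩
  intro a ha b hb hab
  simp only [Finset.coe_filter, Set.mem_ofPred_eq] at ha hb
  by_contra hne
  have heab : e a = b := hR a ha.1 b hb.1 ⟨hne, fun j hj => by
    simpa [hj] using congrFun hab j⟩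
  refine hγ a (by rw [heab]; exact fun h => hne h.symm) ?_
  rw [heab, ha.2, hb.2]

theorem exists_routesAlong {l : List β} (hl : l.Nodup) {f : ι → β → Bool} {S : Finset ι}
    (hf : Set.InjOn f S) (hcard : S.card ≤ 2 ^ l.length) :
    ∃ z, RoutesAlong l f z S := by
  induction l generalizing f S with
  | nil =>
    have h := Finset.card_le_one.mp (by simpa using hcard)
    exact ⟨f, fun _ a ha b hb _ _ => h a ha b hb, fun a ha b hb _ => h a ha b hb⟩
  | cons p l ih =>
    rw [List.nodup_cons] at hl
    obtain ⟨e, he, -, hsplit⟩ := exists_involutive_splitting p hf hcard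
    obtain ⟨γ, hγ, -⟩ := exists_bool_coloring_of_involutive he he
    choose z hz using fun t => ih hl.2 (hsplit γ hγ t).2 (hsplit γ hγ t).1
    exact ⟨_, RoutesAlong.cons hl.1 hf hz⟩

/-- The new value of a designated bit `c` may be prescribed, subject only to separating the pairs
of some involution. -/
theorem exists_involutive_forall_routesAlong {c : β} {l : List β} (hl : l.Nodup) (hc : c ∈ l)
    {f : ι → β → Bool} {S : Finset ι} (hf : Set.InjOn f S) (hcard : S.card ≤ 2 ^ l.length) :
    ∃ e : ι → ι, Function.Involutive e ∧ (∀ a, e a ≠ a → a ∈ S) ∧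
      ∀ γ : ι → Bool, (∀ a, e a ≠ a → γ (e a) ≠ γ a) →
        ∃ z, RoutesAlong l f z S ∧ ∀ a ∈ S, z a c = γ a := by
  induction l generalizing f S with
  | nil => simp at hc
  | cons p l ih =>
    rw [List.nodup_cons] at hl
    obtain ⟨e, he, hsupp, hsplit⟩ := exists_involutive_splitting p hf hcard
    by_cases hcp : c = p
    · subst hcp
      refine ⟨e, he, hsupp, fun γ hγ => ?_⟩
      choose z hz using fun t =>
        exists_routesAlong hl.2 (hsplit γ hγ t).2 (hsplit γ hγ t).1
      exact ⟨_, RoutesAlong.cons hl.1 hf hz, fun a _ => by simp⟩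
    · obtain ⟨δ, hδ, -⟩ := exists_bool_coloring_of_involutive he he
      have hcl : c ∈ l := by simpa [hcp] using hc
      choose g hg hgsupp hgz using fun t =>
        ih hl.2 hcl (hsplit δ hδ t).2 (hsplit δ hδ t).1
      have hgδ (t a) (h : g t a ≠ a) : a ∈ S ∧ δ a = t := by simpa using hgsupp t a h
      have hδg (a) : δ (g (δ a) a) = δ a := by
        by_cases h : g (δ a) a = a
        · rw [h]
        · exact (hgδ (δ a) _ (by rw [hg]; exact fun h' => h h'.symm)).2
      refine ⟨fun a => g (δ a) a, fun a => ?_, fun a ha => (hgδ _ a ha).1, fun γ hγ => ?_⟩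
      · change g (δ (g (δ a) a)) (g (δ a) a) = a
        rw [hδg, hg]
      · choose z hz hzc using fun t => hgz t γ (fun a ha => by
          have h := (hgδ t a ha).2
          subst h
          exact hγ a ha)
        exact ⟨_, RoutesAlong.cons hl.1 hf hz, fun a ha => by
          simpa [hcp] using hzc (δ a) a (by simp [ha])⟩

/-- Strings that can be reached from both `f` and `g` simultaneously, along lists of bits that share
at most one bit. -/
theorem exists_routesAlong_pair {l₁ l₂ : List β} (hl₁ : l₁.Nodup) (hl₂ : l₂.Nodup)
    (hl : ∀ i ∈ l₁, i ∈ l₂ → ∀ j ∈ l₁, j ∈ l₂ → i = j) {f g : ι → β → Bool} {S : Finset ι}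
    (hf : Set.InjOn f S) (hg : Set.InjOn g S)
    (h₁ : S.card ≤ 2 ^ l₁.length) (h₂ : S.card ≤ 2 ^ l₂.length) :
    ∃ z, RoutesAlong l₁ f z S ∧ RoutesAlong l₂ g z S := by
  obtain ⟨z₁, z₂, hz₁, hz₂, hz⟩ : ∃ z₁ z₂ : ι → β → Bool, RoutesAlong l₁ f z₁ S ∧
      RoutesAlong l₂ g z₂ S ∧ ∀ a ∈ S, ∀ j ∈ l₁, j ∈ l₂ → z₁ a j = z₂ a j := by
    by_cases hc : ∃ c ∈ l₁, c ∈ l₂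
    · obtain ⟨c, hc₁, hc₂⟩ := hc
      obtain ⟨e₁, he₁, -, H₁⟩ := exists_involutive_forall_routesAlong hl₁ hc₁ hf h₁
      obtain ⟨e₂, he₂, -, H₂⟩ := exists_involutive_forall_routesAlong hl₂ hc₂ hg h₂
      obtain ⟨γ, hγ₁, hγ₂⟩ := exists_bool_coloring_of_involutive he₁ he₂
      obtain ⟨z₁, hz₁, hc₁'⟩ := H₁ γ hγ₁
      obtain ⟨z₂, hz₂, hc₂'⟩ := H₂ γ hγ₂
      refine ⟨z₁, z₂, hz₁, hz₂, fun a ha j hj₁ hj₂ => ?_⟩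
      rw [← hl c hc₁ hc₂ j hj₁ hj₂, hc₁' a ha, hc₂' a ha]
    · obtain ⟨z₁, hz₁⟩ := exists_routesAlong hl₁ hf h₁
      obtain ⟨z₂, hz₂⟩ := exists_routesAlong hl₂ hg h₂
      exact ⟨z₁, z₂, hz₁, hz₂, fun a _ j hj₁ hj₂ => absurd ⟨j, hj₁, hj₂⟩ hc⟩
  refine ⟨fun a j => if j ∈ l₁ then z₁ a j else z₂ a j, hz₁.congr fun a _ j hj => by simp [hj],
    hz₂.congr fun a ha j hj => ?_⟩
  by_cases hj₁ : j ∈ l₁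
  · simp [hj₁, hz a ha j hj₁ hj]
  · simp [hj₁]

end Routing

theorem mem_take_map_finRange {d : ℕ} (τ : Equiv.Perm (Fin d)) (k : ℕ) (j : Fin d) :
    j ∈ ((List.finRange d).map τ).take k ↔ (τ.symm j : ℕ) < k := by
  rw [List.mem_take_iff_getElem]
  constructor
  · rintro ⟨i, hi, rfl⟩
    simp at hi ⊢
    omega
  · intro h
    exact ⟨τ.symm j, by simp [h], by simp⟩

/-- Node-disjoint paths exist as soon as suitable strings for the middle layer do. -/
theorem exists_paths_of_routesAlong {d L R : ℕ} {π σ : Equiv.Perm (Fin d)} {A : Finset (BStr d)}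
    {ρ : BStr d → BStr d} {z : BStr d → BStr d}
    (hleft : RoutesAlong (((List.finRange d).map π).take L) id z A)
    (hright : RoutesAlong (((List.finRange d).map (Fin.revPerm.trans σ)).take (d - R)) ρ z A) :
    ∃ P : BStr d → Fin (2*d+1) → BStr d,
      (∀ a ∈ A, P a 0 = a) ∧
      (∀ a ∈ A, P a (Fin.last (2*d)) = ρ a) ∧
      (∀ a ∈ A, ∀ i : Fin (2*d),
        lpPairAdj d π σ (i.castSucc, P a i.castSucc) (i.succ, P a i.succ)) ∧
      (∀ a ∈ A, ∀ a' ∈ A, a ≠ a' → ∀ i, P a i ≠ P a' i) := by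
  have hl (k : ℕ) (j : Fin d) : j ∈ (((List.finRange d).map π).take L).take k ↔
      (π.symm j : ℕ) < k ∧ (π.symm j : ℕ) < L := by
    rw [List.take_take, mem_take_map_finRange, lt_min_iff]
  have hr (k : ℕ) (j : Fin d) :
      j ∈ (((List.finRange d).map (Fin.revPerm.trans σ)).take (d - R)).take k ↔
      d ≤ (σ.symm j : ℕ) + k ∧ R ≤ (σ.symm j : ℕ) := by
    rw [List.take_take, mem_take_map_finRange, lt_min_iff]
    have := (σ.symm j).isLt
    simp [Fin.val_rev]
    omega
  have hl' (j : Fin d) : j ∈ ((List.finRange d).map π).take L ↔ (π.symm j : ℕ) < L :=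
    mem_take_map_finRange π L j
  have hr' (j : Fin d) : j ∈ ((List.finRange d).map (Fin.revPerm.trans σ)).take (d - R) ↔
      R ≤ (σ.symm j : ℕ) := by
    rw [mem_take_map_finRange]
    have := (σ.symm j).isLt
    simp [Fin.val_rev]
    omega
  refine ⟨fun a i j => if (i : ℕ) ≤ d then (if (π.symm j : ℕ) < i then z a j else a j)
    else (if (σ.symm j : ℕ) < i - d then ρ a j else z a j), ?_, ?_, ?_, ?_⟩
  · intro a _
    funext j
    simp
  · intro a _
    funext j
    have hj := (σ.symm j).isLt
    have h₁ : ¬ 2 * d ≤ d := by omega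
    have h₂ : (σ.symm j : ℕ) < 2 * d - d := by omega
    simp [h₁, h₂]
  · intro a _ i
    refine ⟨by simp, ?_⟩
    by_cases hi : (i : ℕ) < d
    · refine Or.inl ⟨by simpa using hi, fun j hj => ?_⟩
      have hne : (π.symm j : ℕ) ≠ i := by
        intro h
        apply hj
        rw [← Equiv.symm_apply_eq]
        exact Fin.ext h
      simp only [Fin.val_castSucc, Fin.val_succ]
      grind
    · refine Or.inr ⟨by simp; omega, by simpa using hi, fun j hj => ?_⟩
      have hne : (σ.symm j : ℕ) ≠ i - d := by
        intro h
        apply hj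
        rw [← Equiv.symm_apply_eq]
        exact Fin.ext h
      have := (π.symm j).isLt
      simp only [Fin.val_castSucc, Fin.val_succ]
      grind
  · intro a ha b hb hab i hP
    have hP' := congrFun hP
    clear hP
    apply hab
    by_cases hi : (i : ℕ) ≤ d
    · simp only [hi, if_true] at hP'
      by_cases hiL : (i : ℕ) ≤ L
      · refine hleft.1 i a ha b hb (fun j hj => ?_) fun j hj => ?_
        · rw [hl] at hj
          simpa [hj.1] using hP' j
        · rw [hl] at hj
          have hj' : ¬ (π.symm j : ℕ) < i := by omega
          simpa [hj'] using hP' j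
      · refine hleft.2 a ha b hb fun j hj => ?_
        rw [hl'] at hj
        have hj' : (π.symm j : ℕ) < i := by omega
        simpa [hj'] using hP' j
    · simp only [hi, if_false] at hP'
      by_cases hiR : (i : ℕ) - d ≤ R
      · refine hright.2 a ha b hb fun j hj => ?_
        rw [hr'] at hj
        have hj' : ¬ (σ.symm j : ℕ) < i - d := by omega
        simpa [hj'] using hP' j
      · have := i.isLt
        refine hright.1 (d - (i - d)) a ha b hb (fun j hj => ?_) fun j hj => ?_
        · rw [hr] at hj
          have hj' : ¬ (σ.symm j : ℕ) < i - d := by omega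
          simpa [hj'] using hP' j
        · rw [hr] at hj
          have hj' : (σ.symm j : ℕ) < i - d := by omega
          simpa [hj'] using hP' j

/-- let `G` be a pair of `d`-dimensional layer-permuted butterflies
whose left permutation `π` maps the first `⌊d/2⌋` layers into the first `⌊d/2⌋`
bit positions and whose right permutation `σ` maps the last `⌈d/2⌉`-th-onwards
layers into the last bit positions (stated `1`-based in the paper; here `π i`
`0`-based corresponds to `π(i+1)` `1`-based).  Then any bijection `ρ` from an
input set `A` to an output set `B` with `|A| = |B| ≤ 2^⌊d/2⌋` can be routed by
node-disjoint paths, the path starting at `a` ending at `ρ a`. -/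
theorem pair_of_layer_permuted_butterflies_small_rearrangeable
    (d : ℕ) (π σ : Equiv.Perm (Fin d))
    (hπ : ∀ i : Fin d, (i : ℕ) + 1 ≤ d / 2 → (π i : ℕ) + 1 ≤ d / 2)
    (hσ : ∀ i : Fin d, (d + 1) / 2 ≤ (i : ℕ) + 1 → (d + 1) / 2 ≤ (σ i : ℕ) + 1)
    (A B : Finset (BStr d)) (hAB : A.card = B.card)
    (hsize : A.card ≤ 2 ^ (d / 2))
    (ρ : BStr d → BStr d) (hρ : Set.BijOn ρ ↑A ↑B) :
    ∃ P : BStr d → Fin (2*d+1) → BStr d,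
      (∀ a ∈ A, P a 0 = a) ∧
      (∀ a ∈ A, P a (Fin.last (2*d)) = ρ a) ∧
      (∀ a ∈ A, ∀ i : Fin (2*d),
        lpPairAdj d π σ (i.castSucc, P a i.castSucc) (i.succ, P a i.succ)) ∧
      (∀ a ∈ A, ∀ a' ∈ A, a ≠ a' → ∀ i, P a i ≠ P a' i) := by
  have hleft (j : Fin d) (hj : j ∈ ((List.finRange d).map π).take (d / 2)) :
      (j : ℕ) < d / 2 := by
    rw [mem_take_map_finRange] at hj
    simpa using hπ (π.symm j) hj
  have hright (j : Fin d) (hj : j ∈ ((List.finRange d).map (Fin.revPerm.trans σ)).take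
      (d - ((d + 1) / 2 - 1))) : (d + 1) / 2 ≤ (j : ℕ) + 1 := by
    rw [mem_take_map_finRange] at hj
    have := (σ.symm j).isLt
    simp [Fin.val_rev] at hj
    simpa using hσ (σ.symm j) (by omega)
  have hnodup (τ : Equiv.Perm (Fin d)) (k : ℕ) : (((List.finRange d).map τ).take k).Nodup :=
    ((List.nodup_finRange d).map τ.injective).sublist (List.take_sublist _ _)
  obtain ⟨z, hz₁, hz₂⟩ := exists_routesAlong_pair (hnodup π (d / 2))
    (hnodup (Fin.revPerm.trans σ) (d - ((d + 1) / 2 - 1)))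
    (fun i hi₁ hi₂ j hj₁ hj₂ => by
      have := hleft i hi₁
      have := hright i hi₂
      have := hleft j hj₁
      have := hright j hj₂
      exact Fin.ext (by omega))
    (f := id) (g := ρ) (S := A) Function.injective_id.injOn hρ.injOn
    (hsize.trans (Nat.pow_le_pow_right two_pos (by simp; omega)))
    (hsize.trans (Nat.pow_le_pow_right two_pos (by simp; omega)))
  exact exists_paths_of_routesAlong hz₁ hz₂
end

section
/- Let G be a pair of d-dimensional layer-permuted butterflies (with arbitrary layer permutations π on the left and σ on the right). Then G is a superconcentrator: for every set A of input nodes and every set B of output nodes with |A| = |B|, there exist |A| node-disjoint directed paths from A to B. -/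
namespace LayerPermutedButterfly

open Function

/-- Two fixed-point-free involutions admit a common 2-colouring that both of them reverse. -/
theorem exists_coloring_of_involutive {X : Type*} {a b : X → X}
    (ha : Involutive a) (hb : Involutive b) (ha' : ∀ x, a x ≠ x) (hb' : ∀ x, b x ≠ x) :
    ∃ c : X → Bool, (∀ x, c (a x) = !c x) ∧ ∀ x, c (b x) = !c x := by
  classical
  set p : Equiv.Perm X := ha.toPerm
  set q : Equiv.Perm X := hb.toPerm
  have hp : p * p = 1 := Equiv.ext ha
  have hq : q * q = 1 := Equiv.ext hb
  set r : Equiv.Perm X := p * q with hr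
  have hpr : ∀ n : ℤ, p * r ^ n = r ^ (-n) * p := by
    intro n
    have h1 : p * r * p⁻¹ = r⁻¹ := by
      rw [inv_eq_of_mul_eq_one_right hp, hr, mul_inv_rev, inv_eq_of_mul_eq_one_right hp,
        inv_eq_of_mul_eq_one_right hq, ← mul_assoc, hp, one_mul]
    rw [zpow_neg, ← inv_zpow, ← h1, conj_zpow, inv_mul_cancel_right]
  have hne : ∀ x, ¬ r.SameCycle x (a x) := by
    rintro x ⟨n, hn⟩
    obtain ⟨m, rfl | rfl⟩ := Int.even_or_odd' n
    · refine ha' ((r ^ m) x) ?_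
      have h1 : a ((r ^ m) x) = (r ^ (-m)) (a x) := congrArg (fun e : Equiv.Perm X => e x) (hpr m)
      rw [h1, ← hn, ← Equiv.Perm.mul_apply, ← zpow_add]
      congr 2
      ring
    · refine hb' ((r ^ m) x) (ha.injective ?_)
      have h1 : a ((r ^ m) x) = (r ^ (-m)) (a x) := congrArg (fun e : Equiv.Perm X => e x) (hpr m)
      have h2 : a (b ((r ^ m) x)) = (r ^ (1 + m)) x := by
        rw [zpow_add, zpow_one]; rfl
      rw [h1, h2, ← hn, ← Equiv.Perm.mul_apply, ← zpow_add]
      congr 2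
      ring
  let rep : X → X := fun x => (Quotient.mk (Equiv.Perm.SameCycle.setoid r) x).out
  have hrep : ∀ {x y}, r.SameCycle x y → rep x = rep y := fun h =>
    congrArg Quotient.out (Quotient.sound (s := Equiv.Perm.SameCycle.setoid r) h)
  have hrep' : ∀ {x y}, rep x = rep y → r.SameCycle x y := fun h =>
    Quotient.exact (s := Equiv.Perm.SameCycle.setoid r) (Quotient.out_injective h)
  have hab : ∀ x, rep (b x) = rep (a x) := fun x =>
    hrep ⟨1, by rw [zpow_one]; exact congrArg a (hb x)⟩
  have hab' : ∀ x, rep (a (b x)) = rep x := fun x =>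
    (hrep ⟨1, by rw [zpow_one]; rfl⟩).symm
  have hca : ∀ x, decide (WellOrderingRel (rep (a x)) (rep x)) =
      !decide (WellOrderingRel (rep x) (rep (a x))) := by
    intro x
    rcases trichotomous_of WellOrderingRel (rep x) (rep (a x)) with h | h | h
    · simp [h, asymm h]
    · exact absurd (hrep' h) (hne x)
    · simp [h, asymm h]
  refine ⟨fun x => decide (WellOrderingRel (rep x) (rep (a x))), fun x => ?_, fun x => ?_⟩
  · simp only [ha x]
    exact hca x
  · simp only [hab, hab']
    exact hca x

section Labelling

variable {α : Type*} {f g : α → ℕ → Bool} {V : Finset α} {d : ℕ}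

/-- The number of `x ∈ S` whose label `f x` agrees with `w` on the first `i` letters. -/
def prefixCount (f : α → ℕ → Bool) (S : Finset α) (i : ℕ) (w : ℕ → Bool) : ℕ :=
  (S.filter fun x => ∀ j < i, f x j = w j).card

/-- Each binary word of length `d` is the length-`d` prefix of the label of a unique `x ∈ V`. -/
def PrefixComplete (f : α → ℕ → Bool) (V : Finset α) (d : ℕ) : Prop :=
  ∀ w : ℕ → Bool, ∃ x ∈ V, (∀ j < d, f x j = w j) ∧ ∀ y ∈ V, (∀ j < d, f y j = w j) → y = x

/-- At level `i`, the prefix classes of `S` are split as evenly as possible by the next letter. -/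
def SplitsEvenly (f : α → ℕ → Bool) (S : Finset α) (i : ℕ) : Prop :=
  ∀ w : ℕ → Bool, prefixCount f S (i + 1) w ≤ prefixCount f S (i + 1) (update w i (!w i)) + 1

theorem forall_lt_succ_eq_update {u w : ℕ → Bool} {i : ℕ} {β : Bool} :
    (∀ j < i + 1, u j = update w i β j) ↔ (∀ j < i, u j = w j) ∧ u i = β := by
  constructor
  · intro h
    refine ⟨fun j hj => ?_, by simpa using h i (by omega)⟩
    simpa [update_of_ne hj.ne] using h j (by omega)
  · rintro ⟨h, h'⟩ j hj
    rcases Nat.lt_succ_iff_lt_or_eq.mp hj with h1 | rfl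
    · simpa [update_of_ne h1.ne] using h j h1
    · simpa using h'

theorem prefixCount_update (S : Finset α) (i : ℕ) (w : ℕ → Bool) (β : Bool) :
    prefixCount f S (i + 1) (update w i β) =
      (S.filter fun x => (∀ j < i, f x j = w j) ∧ f x i = β).card := by
  simp only [prefixCount, forall_lt_succ_eq_update]

theorem prefixCount_eq_add (f : α → ℕ → Bool) (S : Finset α) (i : ℕ) (w : ℕ → Bool) :
    prefixCount f S i w = prefixCount f S (i + 1) (update w i true) +
      prefixCount f S (i + 1) (update w i false) := by
  rw [prefixCount_update, prefixCount_update, prefixCount,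
    ← Finset.card_filter_add_card_filter_not (p := fun x => f x i = true), Finset.filter_filter,
    Finset.filter_filter]
  simp

theorem PrefixComplete.prefixCount_eq (h : PrefixComplete f V d) {m i : ℕ} (hm : i + m = d)
    (w : ℕ → Bool) : prefixCount f V i w = 2 ^ m := by
  induction m generalizing i w with
  | zero =>
    obtain rfl : i = d := by omega
    obtain ⟨x, hx, hxw, hu⟩ := h w
    rw [prefixCount, pow_zero, Finset.card_eq_one]
    refine ⟨x, Finset.ext fun y => ?_⟩
    rw [Finset.mem_filter, Finset.mem_singleton]
    exact ⟨fun hy => hu y hy.1 hy.2, fun hy => hy ▸ ⟨hx, hxw⟩⟩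
  | succ m ih =>
    rw [prefixCount_eq_add, ih (by omega), ih (by omega)]
    ring

theorem PrefixComplete.card_eq (h : PrefixComplete f V d) : V.card = 2 ^ d := by
  rw [← h.prefixCount_eq (zero_add d) fun _ => false]
  simp [prefixCount]

/-- The pairing of elements whose labels differ exactly at the last relevant letter. -/
theorem PrefixComplete.exists_involutive (h : PrefixComplete f V (d + 1)) :
    ∃ a : V → V, Involutive a ∧ (∀ x, a x ≠ x) ∧
      ∀ x y : V, (∀ j < d, f y j = f x j) ↔ y = x ∨ y = a x := by
  choose x hx hxw hu using h
  have ha : ∀ v : V, (∀ j < d, f (x (update (f v) d (!f v d))) j = f v j) ∧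
      f (x (update (f v) d (!f v d))) d = !f v d := fun v =>
    forall_lt_succ_eq_update.mp (hxw _)
  refine ⟨fun v => ⟨x (update (f v) d (!f v d)), hx _⟩, fun v => ?_, fun v hv => ?_,
    fun v y => ⟨fun hy => ?_, ?_⟩⟩
  · refine Subtype.ext (hu _ v v.2 (forall_lt_succ_eq_update.mpr ?_)).symm
    simp only [(ha v).2, Bool.not_not, and_true]
    exact fun j hj => ((ha v).1 j hj).symm
  · have := (ha v).2
    have h1 := congrArg Subtype.val hv
    simp only at h1
    rw [h1] at this
    simp at this
  · by_cases hd : f y d = f v d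
    · left
      have h1 := forall_lt_succ_eq_update.mpr ⟨hy, hd⟩
      rw [update_eq_self] at h1
      exact Subtype.ext ((hu _ y y.2 h1).trans (hu _ v v.2 fun _ _ => rfl).symm)
    · right
      refine Subtype.ext (hu _ y y.2 (forall_lt_succ_eq_update.mpr ⟨hy, ?_⟩))
      revert hd
      cases f y d <;> cases f v d <;> simp
  · rintro (rfl | rfl)
    · exact fun _ _ => rfl
    · exact (ha v).1

theorem PrefixComplete.of_coloring (h : PrefixComplete f V (d + 1)) {a : V → V}
    (ha : ∀ x y : V, (∀ j < d, f y j = f x j) ↔ y = x ∨ y = a x) {c : V → Bool}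
    (hc : ∀ x, c (a x) = !c x) {W : Finset α} {β : Bool}
    (hW : ∀ x, x ∈ W ↔ ∃ hx : x ∈ V, c ⟨x, hx⟩ = β) : PrefixComplete f W d := by
  intro w
  obtain ⟨v, hv, hvw, -⟩ := h w
  obtain ⟨u, hu, hu'⟩ : ∃ u : V, (∀ j < d, f u j = w j) ∧ c u = β := by
    by_cases hcv : c ⟨v, hv⟩ = β
    · exact ⟨⟨v, hv⟩, fun j hj => hvw j (by omega), hcv⟩
    · refine ⟨a ⟨v, hv⟩, fun j hj => ?_, ?_⟩
      · rw [(ha ⟨v, hv⟩ (a ⟨v, hv⟩)).mpr (Or.inr rfl) j hj]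
        exact hvw j (by omega)
      · rw [hc]
        revert hcv
        cases c ⟨v, hv⟩ <;> cases β <;> simp
  refine ⟨u, (hW u).mpr ⟨u.2, hu'⟩, hu, fun y hy hyw => ?_⟩
  obtain ⟨hyV, hyc⟩ := (hW y).mp hy
  rcases (ha u ⟨y, hyV⟩).mp fun j hj => (hyw j hj).trans (hu j hj).symm with h1 | h1
  · exact congrArg Subtype.val h1
  · rw [h1, hc, hu'] at hyc
    simp at hyc

/-- A set on which two labellings are complete can be cut into two halves on which both are
complete for words shorter by one letter. -/
theorem PrefixComplete.exists_halves (hf : PrefixComplete f V (d + 1))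
    (hg : PrefixComplete g V (d + 1)) :
    ∃ V₀ ⊆ V, ∃ V₁ ⊆ V, Disjoint V₀ V₁ ∧ (PrefixComplete f V₀ d ∧ PrefixComplete g V₀ d) ∧
      PrefixComplete f V₁ d ∧ PrefixComplete g V₁ d := by
  classical
  obtain ⟨a, haa, ha', ha⟩ := hf.exists_involutive
  obtain ⟨b, hbb, hb', hb⟩ := hg.exists_involutive
  obtain ⟨c, hca, hcb⟩ := exists_coloring_of_involutive haa hbb ha' hb'
  have hW : ∀ β x, (x ∈ V.filter fun x => ∃ hx : x ∈ V, c ⟨x, hx⟩ = β) ↔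
      ∃ hx : x ∈ V, c ⟨x, hx⟩ = β := fun β x => by
    rw [Finset.mem_filter]
    exact ⟨fun h => h.2, fun h => ⟨h.1, h⟩⟩
  refine ⟨_, Finset.filter_subset _ _, _, Finset.filter_subset _ _, ?_,
    ⟨hf.of_coloring ha hca (hW true), hg.of_coloring hb hcb (hW true)⟩,
    hf.of_coloring ha hca (hW false), hg.of_coloring hb hcb (hW false)⟩
  refine Finset.disjoint_left.mpr fun x hx hx' => ?_
  obtain ⟨h1, h2⟩ := (hW true x).mp hx
  obtain ⟨h3, h4⟩ := (hW false x).mp hx'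
  simp [h2] at h4

theorem PrefixComplete.splitsEvenly_of_subset (h : PrefixComplete f V (d + 1)) {S : Finset α}
    (hS : S ⊆ V) : SplitsEvenly f S d := fun w => by
  have h1 : prefixCount f S (d + 1) w ≤ prefixCount f V (d + 1) w :=
    Finset.card_le_card (Finset.filter_subset_filter _ hS)
  rw [h.prefixCount_eq (add_zero _)] at h1
  omega

theorem SplitsEvenly.union_prefixComplete [DecidableEq α] {S : Finset α} {i : ℕ}
    (hS : SplitsEvenly f S i) (hV : PrefixComplete f V d) (hi : i < d) (hd : Disjoint V S) :
    SplitsEvenly f (V ∪ S) i := fun w => by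
  have h1 : ∀ w, prefixCount f (V ∪ S) (i + 1) w =
      prefixCount f V (i + 1) w + prefixCount f S (i + 1) w := fun w => by
    rw [prefixCount, Finset.filter_union, Finset.card_union_of_disjoint
      (Finset.disjoint_filter_filter hd)]
    rfl
  have h2 : i + 1 + (d - (i + 1)) = d := by omega
  rw [h1, h1, hV.prefixCount_eq h2, hV.prefixCount_eq h2]
  have := hS w
  omega

/-- For any two complete labellings there are sets of every size that both split evenly. -/
theorem PrefixComplete.exists_splitsEvenly (hf : PrefixComplete f V d) (hg : PrefixComplete g V d)
    {k : ℕ} (hk : k ≤ 2 ^ d) :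
    ∃ S ⊆ V, S.card = k ∧ ∀ i < d, SplitsEvenly f S i ∧ SplitsEvenly g S i := by
  classical
  induction d generalizing V k with
  | zero =>
    obtain ⟨S, hS, hSk⟩ := Finset.exists_subset_card_eq (hk.trans hf.card_eq.ge)
    exact ⟨S, hS, hSk, fun i hi => absurd hi (Nat.not_lt_zero i)⟩
  | succ d ih =>
    obtain ⟨V₀, hV₀, V₁, hV₁, hdisj, ⟨hf₀, hg₀⟩, hf₁, hg₁⟩ := hf.exists_halves hg
    by_cases hk' : k ≤ 2 ^ d
    · obtain ⟨S, hS, hSk, hSe⟩ := ih hf₀ hg₀ hk'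
      have hSV := hS.trans hV₀
      refine ⟨S, hSV, hSk, fun i hi => ?_⟩
      rcases Nat.lt_succ_iff_lt_or_eq.mp hi with h | rfl
      · exact hSe i h
      · exact ⟨hf.splitsEvenly_of_subset hSV, hg.splitsEvenly_of_subset hSV⟩
    · obtain ⟨S, hS, hSk, hSe⟩ := ih hf₁ hg₁ (k := k - 2 ^ d) (by rw [pow_succ] at hk; omega)
      have hd := hdisj.mono_right hS
      have hSV := Finset.union_subset hV₀ (hS.trans hV₁)
      refine ⟨V₀ ∪ S, hSV, ?_, fun i hi => ?_⟩
      · rw [Finset.card_union_of_disjoint hd, hf₀.card_eq]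
        omega
      rcases Nat.lt_succ_iff_lt_or_eq.mp hi with h | rfl
      · exact ⟨(hSe i h).1.union_prefixComplete hf₀ h hd,
          (hSe i h).2.union_prefixComplete hg₀ h hd⟩
      · exact ⟨hf.splitsEvenly_of_subset hSV, hg.splitsEvenly_of_subset hSV⟩

end Labelling

section Routing

variable {d : ℕ} {π : Equiv.Perm (Fin d)} {A S : Finset (BStr d)}

/-- The bits of `x` listed in the order in which a butterfly with layer permutation `π` meets them,
padded by `false`. -/
def bitSeq (π : Equiv.Perm (Fin d)) (x : BStr d) (j : ℕ) : Bool :=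
  if h : j < d then x (π ⟨j, h⟩) else false

theorem bitSeq_agree_iff {x y : BStr d} : (∀ j < d, bitSeq π x j = bitSeq π y j) ↔ x = y := by
  refine ⟨fun h => funext fun i => ?_, fun h _ _ => h ▸ rfl⟩
  simpa [bitSeq] using h (π.symm i) (π.symm i).2

theorem prefixComplete_bitSeq (π : Equiv.Perm (Fin d)) :
    PrefixComplete (bitSeq π) Finset.univ d := fun w => by
  have h : ∀ j < d, bitSeq π (fun i => w (π.symm i)) j = w j := fun j hj => by
    simp [bitSeq, hj]
  refine ⟨fun i => w (π.symm i), Finset.mem_univ _, h, fun y _ hy => ?_⟩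
  exact bitSeq_agree_iff.mp fun j hj => (hy j hj).trans (h j hj).symm

theorem mem_iff_prefixCount_pos {T : Finset (BStr d)} {y : BStr d} :
    y ∈ T ↔ 0 < prefixCount (bitSeq π) T d (bitSeq π y) := by
  rw [prefixCount, Finset.card_pos]
  simp only [bitSeq_agree_iff]
  exact ⟨fun h => ⟨y, by simpa using h⟩, fun ⟨x, hx⟩ => by
    obtain ⟨h1, rfl⟩ := Finset.mem_filter.mp hx
    exact h1⟩

theorem bitSeq_update_of_lt {i j : ℕ} (hi : i < d) (hj : j < i) (x : BStr d) (β : Bool) :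
    bitSeq π (update x (π ⟨i, hi⟩) β) j = bitSeq π x j := by
  have h1 : j < d := hj.trans hi
  have h2 : π ⟨j, h1⟩ ≠ π ⟨i, hi⟩ := fun h => by
    have := congrArg Fin.val (π.injective h)
    simp only at this
    omega
  simp [bitSeq, h1, update_of_ne h2]

/-- One layer of routing: if `A` and `S` have the same number of elements in each prefix class of
length `i` and `S` splits evenly, then `A` can be moved along the next layer, without collisions,
so that the same holds for prefixes of length `i + 1`. -/
theorem exists_layer_routing {i : ℕ} (hi : i < d)
    (hAS : ∀ w, prefixCount (bitSeq π) A i w = prefixCount (bitSeq π) S i w)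
    (hS : SplitsEvenly (bitSeq π) S i) :
    ∃ φ : BStr d → BStr d, Set.InjOn φ A ∧ (∀ x, ∀ j, j ≠ π ⟨i, hi⟩ → φ x j = x j) ∧
      ∀ w, prefixCount (bitSeq π) (A.image φ) (i + 1) w = prefixCount (bitSeq π) S (i + 1) w := by
  classical
  set e := π ⟨i, hi⟩ with he
  let flip : BStr d → BStr d := fun x => update x e (!x e)
  have hflip : Involutive flip := fun x => by simp [flip]
  have hpre : ∀ (x : BStr d) (β : Bool) (w : ℕ → Bool),
      (∀ j < i, bitSeq π (update x e β) j = w j) ↔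
      ∀ j < i, bitSeq π x j = w j := fun x β w =>
    forall₂_congr fun j hj => by rw [bitSeq_update_of_lt hi hj]
  have hbit : ∀ x, bitSeq π x i = x e := fun x => by simp [bitSeq, hi, he]
  let full : (ℕ → Bool) → Bool → ℕ := fun w β =>
    (A.filter fun x => (∀ j < i, bitSeq π x j = w j) ∧ flip x ∈ A ∧ x e = β).card
  let single : (ℕ → Bool) → Finset (BStr d) := fun w =>
    A.filter fun x => (∀ j < i, bitSeq π x j = w j) ∧ flip x ∉ A
  let s : (ℕ → Bool) → Bool → ℕ := fun w β => prefixCount (bitSeq π) S (i + 1) (update w i β)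
  have hfull : ∀ w, full w false = full w true := fun w => by
    refine Finset.card_bij' (fun x _ => flip x) (fun x _ => flip x) ?_ ?_
      (fun x _ => hflip x) (fun x _ => hflip x)
    all_goals
      intro x hx
      simp only [Finset.mem_filter] at hx ⊢
      refine ⟨hx.2.2.1, (hpre _ _ _).mpr hx.2.1, (hflip x).symm ▸ hx.1, ?_⟩
      simp [flip, hx.2.2.2]
  have hcount : ∀ w, prefixCount (bitSeq π) A i w =
      full w true + full w false + (single w).card := fun w => by
    rw [prefixCount, ← Finset.card_filter_add_card_filter_not (p := fun x => flip x ∈ A),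
      ← Finset.card_filter_add_card_filter_not
        (s := Finset.filter (fun x => flip x ∈ A) _) (p := fun x => x e = true)]
    simp only [Finset.filter_filter, full, single, and_assoc, Bool.not_eq_true]
  have hs : ∀ w, full w true ≤ s w true ∧ s w true ≤ full w true + (single w).card := fun w => by
    have h1 := hcount w
    have h2 := prefixCount_eq_add (bitSeq π) S i w
    have h3 := hS (update w i true)
    have h4 := hS (update w i false)
    have h5 := hfull w
    simp only [update_self, update_idem, Bool.not_true, Bool.not_false] at h3 h4
    rw [hAS] at h1
    simp only [s]
    omega
  have hU : ∀ w, ∃ U ⊆ single w, U.card = s w true - full w true := fun w =>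
    Finset.exists_subset_card_eq (by have := hs w; omega)
  choose U hUsub hUcard using hU
  let tr : (ℕ → Bool) → ℕ → Bool := fun w j => if j < i then w j else false
  have htr : ∀ u w : ℕ → Bool, (∀ j < i, u j = w j) → tr u = tr w := fun u w h => by
    funext j
    by_cases hj : j < i
    · simp [tr, hj, h j hj]
    · simp [tr, hj]
  have htr' : ∀ w, ∀ j < i, tr w j = w j := fun w j hj => by simp [tr, hj]
  let φ : BStr d → BStr d := fun x =>
    if flip x ∈ A then x else update x e (decide (x ∈ U (tr (bitSeq π x))))
  have hφe : ∀ x, ∀ j, j ≠ e → φ x j = x j := fun x j hj => by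
    by_cases h : flip x ∈ A
    · simp [φ, h]
    · simp [φ, h, update_of_ne hj]
  have hφpre : ∀ (x : BStr d) (w : ℕ → Bool),
      (∀ j < i, bitSeq π (φ x) j = w j) ↔ ∀ j < i, bitSeq π x j = w j := by
    intro x w
    by_cases h : flip x ∈ A
    · simp [φ, h]
    · simp only [φ, h, if_false, hpre]
  have hinj : Set.InjOn φ A := fun x hx y hy hxy => by
    have h1 : ∀ j, j ≠ e → y j = x j := fun j hj => by
      rw [← hφe x j hj, ← hφe y j hj, hxy]
    by_cases h2 : y e = x e
    · funext j
      by_cases hj : j = e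
      · rw [hj, h2]
      · exact (h1 j hj).symm
    · have h3 : flip x = y := by
        funext j
        by_cases hj : j = e
        · subst hj
          revert h2
          simp only [flip, update_self]
          cases y e <;> cases x e <;> simp
        · simp [flip, update_of_ne hj, h1 j hj]
      have h4 : flip x ∈ A := h3 ▸ hy
      have h5 : flip y ∈ A := by rw [← h3, hflip]; exact hx
      simpa [φ, h4, h5] using hxy
  have himage : ∀ w β, prefixCount (bitSeq π) (A.image φ) (i + 1) (update w i β) =
      (A.filter fun x => (∀ j < i, bitSeq π x j = w j) ∧ φ x e = β).card := fun w β => by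
    rw [prefixCount_update, Finset.filter_image, Finset.card_image_of_injOn
      (hinj.mono (Finset.coe_subset.mpr (Finset.filter_subset _ _)))]
    simp only [hφpre, hbit]
  have htrue : ∀ w, prefixCount (bitSeq π) (A.image φ) (i + 1) (update w i true) = s w true := by
    intro w
    have h1 : (A.filter fun x => ((∀ j < i, bitSeq π x j = w j) ∧ φ x e = true) ∧ flip x ∉ A) =
        U (tr w) := by
      ext x
      simp only [Finset.mem_filter]
      constructor
      · rintro ⟨-, ⟨hxw, hx⟩, hxA⟩
        simpa [φ, hxA, htr _ _ hxw] using hx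
      · intro hx
        obtain ⟨hxA, hxw, hxf⟩ := Finset.mem_filter.mp (hUsub _ hx)
        have hxw' : ∀ j < i, bitSeq π x j = w j := fun j hj => (hxw j hj).trans (htr' w j hj)
        exact ⟨hxA, ⟨hxw', by simpa [φ, hxf, htr _ _ hxw'] using hx⟩, hxf⟩
    have h2 : (A.filter fun x => ((∀ j < i, bitSeq π x j = w j) ∧ φ x e = true) ∧ flip x ∈ A).card
        = full w true := by
      refine congrArg Finset.card (Finset.filter_congr fun x _ => ?_)
      constructor
      · rintro ⟨⟨hxw, hx⟩, hxA⟩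
        exact ⟨hxw, hxA, by simpa [φ, hxA] using hx⟩
      · rintro ⟨hxw, hxA, hx⟩
        exact ⟨⟨hxw, by simpa [φ, hxA] using hx⟩, hxA⟩
    have h3 : s (tr w) true = s w true := by
      simp only [s, prefixCount_update]
      exact congrArg Finset.card (Finset.filter_congr fun x _ => and_congr_left fun _ =>
        forall₂_congr fun j hj => by rw [htr' w j hj])
    have h4 : full (tr w) true = full w true :=
      congrArg Finset.card (Finset.filter_congr fun x _ => and_congr_left fun _ =>
        forall₂_congr fun j hj => by rw [htr' w j hj])
    rw [himage, ← Finset.card_filter_add_card_filter_not (p := fun x => flip x ∈ A),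
      Finset.filter_filter, Finset.filter_filter, h1, h2, hUcard, h3, h4]
    have := (hs w).1
    omega
  have himage' : ∀ w, prefixCount (bitSeq π) (A.image φ) i w = prefixCount (bitSeq π) A i w := by
    intro w
    rw [prefixCount, Finset.filter_image, Finset.card_image_of_injOn
      (hinj.mono (Finset.coe_subset.mpr (Finset.filter_subset _ _)))]
    simp only [hφpre, prefixCount]
  refine ⟨φ, hinj, hφe, fun w => ?_⟩
  have h1 := prefixCount_eq_add (bitSeq π) (A.image φ) i w
  have h2 := prefixCount_eq_add (bitSeq π) S i w
  have h3 := htrue w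
  rw [himage', hAS] at h1
  simp only [s] at h3
  rw [← update_eq_self i w]
  cases w i
  · omega
  · exact h3

/-- A set of inputs of a butterfly can be routed to any set of outputs of the same size that all
layers split evenly. -/
theorem exists_routing (hcard : A.card = S.card)
    (hS : ∀ i < d, SplitsEvenly (bitSeq π) S i) :
    ∃ R : BStr d → ℕ → BStr d, (∀ a, R a 0 = a) ∧
      (∀ a, ∀ i (h : i < d), ∀ j, j ≠ π ⟨i, h⟩ → R a i j = R a (i + 1) j) ∧
      (∀ i ≤ d, Set.InjOn (fun a => R a i) A) ∧ A.image (fun a => R a d) = S := by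
  classical
  have h : ∀ n ≤ d, ∃ R : BStr d → ℕ → BStr d, (∀ a, R a 0 = a) ∧
      (∀ a, ∀ i (h : i < d), i < n → ∀ j, j ≠ π ⟨i, h⟩ → R a i j = R a (i + 1) j) ∧
      (∀ i ≤ n, Set.InjOn (fun a => R a i) A) ∧
      ∀ w, prefixCount (bitSeq π) (A.image fun a => R a n) n w =
        prefixCount (bitSeq π) S n w := by
    intro n
    induction n with
    | zero =>
      refine fun _ => ⟨fun a _ => a, fun _ => rfl, fun _ _ _ _ _ _ => rfl,
        fun _ _ => Set.injOn_id _, fun w => ?_⟩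
      simpa [prefixCount] using hcard
    | succ n ih =>
      intro hn
      obtain ⟨R, h0, hadj, hinj, hcount⟩ := ih (by omega)
      obtain ⟨φ, hφ, hφe, hφc⟩ := exists_layer_routing (by omega) hcount (hS n (by omega))
      refine ⟨fun a i => if i ≤ n then R a i else φ (R a n), fun a => by simp [h0],
        fun a i h hi j hj => ?_, fun i hi => ?_, fun w => ?_⟩
      · rcases Nat.lt_succ_iff_lt_or_eq.mp hi with h1 | rfl
        · simpa [h1.le, Nat.succ_le_of_lt h1] using hadj a i h h1 j hj
        · simpa using (hφe (R a i) j hj).symm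
      · by_cases h : i ≤ n
        · simpa [h] using hinj i h
        · simp only [h, if_false]
          intro a ha b hb hab
          exact hinj n le_rfl ha hb (hφ (Finset.mem_coe.mpr (Finset.mem_image_of_mem _ ha))
            (Finset.mem_coe.mpr (Finset.mem_image_of_mem _ hb)) hab)
      · rw [← hφc, Finset.image_image]
        simp [comp_def]
  obtain ⟨R, h0, hadj, hinj, hcount⟩ := h d le_rfl
  refine ⟨R, h0, fun a i h => hadj a i h h, hinj, Finset.ext fun y => ?_⟩
  rw [mem_iff_prefixCount_pos (π := π), hcount, ← mem_iff_prefixCount_pos]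

end Routing

end LayerPermutedButterfly

/-- every pair of `d`-dimensional layer-permuted butterflies is a
superconcentrator: any input set `A` and output set `B` with `|A| = |B|` are
joined by `|A|` node-disjoint directed paths. -/
theorem pair_of_layer_permuted_butterflies_superconcentrator
    (d : ℕ) (π σ : Equiv.Perm (Fin d))
    (A B : Finset (BStr d)) (hAB : A.card = B.card) :
    ∃ P : BStr d → Fin (2*d+1) → BStr d,
      IsPathSystemOn d (lpPairAdj d π σ) A B P := by
  classical
  obtain ⟨S, -, hSA, hS⟩ := (LayerPermutedButterfly.prefixComplete_bitSeq π).exists_splitsEvenly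
    (LayerPermutedButterfly.prefixComplete_bitSeq (Fin.revPerm.trans σ)) (k := A.card)
    (A.card_le_univ.trans (by simp))
  obtain ⟨Q, hQ0, hQadj, hQinj, hQS⟩ :=
    LayerPermutedButterfly.exists_routing hSA.symm fun i hi => (hS i hi).1
  obtain ⟨R, hR0, hRadj, hRinj, hRS⟩ :=
    LayerPermutedButterfly.exists_routing (hSA.trans hAB).symm fun i hi => (hS i hi).2
  have hb : ∀ a, ∃ b, a ∈ A → b ∈ B ∧ R b d = Q a d := fun a => by
    by_cases ha : a ∈ A
    · have h1 : Q a d ∈ B.image fun b => R b d := by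
        rw [hRS, ← hQS]
        exact Finset.mem_image_of_mem (fun a => Q a d) ha
      obtain ⟨b, hb, hbQ⟩ := Finset.mem_image.mp h1
      exact ⟨b, fun _ => ⟨hb, hbQ⟩⟩
    · exact ⟨a, fun h => absurd h ha⟩
  choose b hb using hb
  have hP : ∀ a ∈ A, ∀ i, d ≤ i → (if i ≤ d then Q a i else R (b a) (2 * d - i)) =
      R (b a) (2 * d - i) := fun a ha i hi => by
    split_ifs with h
    · obtain rfl : i = d := le_antisymm h hi
      rw [← (hb a ha).2]
      congr 1
      omega
    · rfl
  have hlast : ∀ a ∈ A, (if 2 * d ≤ d then Q a (2 * d) else R (b a) (2 * d - 2 * d)) = b a :=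
    fun a ha => by rw [hP a ha _ (by omega), Nat.sub_self, hR0]
  refine ⟨fun a i => if (i : ℕ) ≤ d then Q a i else R (b a) (2 * d - i), ?_, ?_, ?_, ?_, ?_⟩
  · intro a _
    simp [hQ0]
  · intro a ha i
    refine ⟨by simp, ?_⟩
    simp only [Fin.val_castSucc, Fin.val_succ]
    by_cases h : (i : ℕ) < d
    · refine Or.inl ⟨h, fun j hj => ?_⟩
      rw [if_pos h.le, if_pos (Nat.succ_le_of_lt h)]
      exact hQadj a i h j hj
    · have hi := i.2
      refine Or.inr ⟨by omega, by omega, fun j hj => ?_⟩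
      rw [hP a ha _ (by omega), hP a ha _ (by omega)]
      have h1 : 2 * d - i = 2 * d - (i + 1) + 1 := by omega
      rw [h1]
      refine (hRadj (b a) _ (by omega) j fun hj' => hj ?_).symm
      rw [hj', Equiv.trans_apply, Fin.revPerm_apply]
      congr 1
      ext
      simp only [Fin.val_rev]
      omega
  · intro a ha
    simp only [Fin.val_last]
    rw [hlast a ha]
    exact (hb a ha).1
  · intro y hy
    have h1 : R y d ∈ A.image fun a => Q a d := by
      rw [hQS, ← hRS]
      exact Finset.mem_image_of_mem (fun a => R a d) hy
    obtain ⟨a, ha, haQ⟩ := Finset.mem_image.mp h1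
    refine ⟨a, ha, ?_⟩
    simp only [Fin.val_last]
    rw [hlast a ha]
    exact hRinj d le_rfl (hb a ha).1 hy ((hb a ha).2.trans haQ)
  · intro a ha a' ha' hne i heq
    simp only at heq
    by_cases h : (i : ℕ) ≤ d
    · rw [if_pos h, if_pos h] at heq
      exact hne (hQinj i h ha ha' heq)
    · rw [if_neg h, if_neg h] at heq
      have h1 := hRinj _ (by omega) (hb a ha).1 (hb a' ha').1 heq
      refine hne (hQinj d le_rfl ha ha' ?_)
      simp only
      rw [← (hb a ha).2, ← (hb a' ha').2, h1]
end
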